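/- arXiv:1211.5023 — 3 statements merged into one kernel-verified Lean document; each statement's English description precedes it below -/
import Mathlib

section
/- Let β = (1+√5)/2, and let m be the (1/2,1/2) Bernoulli measure on {0,1}^ℕ. For m-almost every sequence (a_n), the greedy β-expansion (x_n) of the number ∑ a_n β^{-n} has digit 1 with limiting frequency 5/18, i.e. lim_{N→∞} (1/N) ∑_{n=1}^N x_n = 5/18. -/
open MeasureTheory Filter

/-- The golden mean. -/
noncomputable def goldenMean : ℝ := (1 + Real.sqrt 5) / 2

/-- The greedy β-transformation for the golden mean. -/
noncomputable def greedyT (x : ℝ) : ℝ :=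
  if x < 1 / goldenMean then goldenMean * x else goldenMean * x - 1

/-- The k-th digit (k ≥ 0) of the greedy β-expansion of x. -/
noncomputable def greedyDigit (x : ℝ) (k : ℕ) : ℝ :=
  if 1 / goldenMean ≤ greedyT^[k] x then 1 else 0

/-- The projection π(a) = ∑ aₙ β⁻ⁿ (digits indexed from 0, so the weight of `a n`
is β^{-(n+1)}). -/
noncomputable def projPi (a : ℕ → Fin 2) : ℝ :=
  ∑' n : ℕ, (a n : ℝ) * goldenMean ^ (-((n : ℤ) + 1))

/-- `m` is the (1/2,1/2) Bernoulli measure on {0,1}^ℕ. -/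
def IsBernoulliHalf (m : Measure (ℕ → Fin 2)) : Prop :=
  IsProbabilityMeasure m ∧
    ∀ (s : Finset ℕ) (f : ℕ → Fin 2),
      m {a | ∀ i ∈ s, a i = f i} = (1 / 2 : ENNReal) ^ s.card

namespace GoldenFreq

local notation "β" => goldenMean

lemma beta_sq : β ^ 2 = β + 1 := by
  unfold goldenMean
  nlinarith [Real.sq_sqrt (show (0:ℝ) ≤ 5 by norm_num)]

lemma beta_gt : 1.6 < β := by
  unfold goldenMean
  have : (2.2:ℝ) < Real.sqrt 5 := Real.lt_sqrt_of_sq_lt (by norm_num)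
  linarith

lemma beta_lt : β < 1.7 := by
  unfold goldenMean
  have : Real.sqrt 5 < 2.4 := by
    rw [Real.sqrt_lt' (by norm_num)]; norm_num
  linarith

lemma beta_pos : 0 < β := by linarith [beta_gt]

lemma inv_beta : 1 / β = β - 1 := by
  have := beta_pos
  rw [div_eq_iff this.ne']
  nlinarith [beta_sq]

/-- digit of a Boolean -/
def dg (b : Bool) : ℝ := if b then 1 else 0

/-- value of a stack, top first -/
noncomputable def sv : List Bool → ℝ
  | [] => 0
  | b :: r => dg b + β * sv r

def ones : List Bool → ℤ
  | [] => 0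
  | true :: r => 1 + ones r
  | false :: r => ones r

def run : List Bool → ℕ
  | true :: false :: r => run r + 1
  | _ => 0

def push1 : List Bool → List Bool
  | true :: false :: r => false :: false :: push1 r
  | r => true :: r

def Valid : List Bool → Prop
  | [] => True
  | false :: r => Valid r
  | [true] => True
  | true :: false :: r => Valid r
  | true :: true :: _ => False

lemma push1_length (s : List Bool) : (push1 s).length = s.length + 1 := by
  fun_induction push1 s <;> simp_all

lemma ones_push1 (s : List Bool) : ones (push1 s) = ones s + 1 - run s := by
  fun_induction push1 s with
  | case1 r ih => simp [ones, run, ih]; ring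
  | case2 r h =>
    have : run r = 0 := by
      unfold run
      split
      · exact absurd rfl (h _)
      · rfl
    simp [ones, this]; ring

lemma sv_push1 (s : List Bool) : sv (push1 s) = 1 + β * sv s := by
  fun_induction push1 s with
  | case1 r ih => simp [sv, dg, ih]; linear_combination beta_sq
  | case2 r h => simp [sv, dg]

lemma valid_push1 (s : List Bool) (hs : Valid s) :
    Valid (push1 s) ∨ β ^ (s.length + 1) ≤ sv (push1 s) := by
  fun_induction push1 s with
  | case1 r ih =>
    rcases ih (by simpa [Valid] using hs) with h | h
    · left; simpa [Valid] using h
    · right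
      simp only [sv, dg, List.length_cons]
      have := beta_pos
      have h2 : β * β * β ^ (r.length + 1) ≤ β * β * sv (push1 r) := by gcongr
      simp
      calc _ = β * β * β ^ (r.length + 1) := by ring
        _ ≤ _ := h2
        _ = _ := by ring
  | case2 r h =>
    match r, hs, h with
    | [], _, _ => left; simp [Valid]
    | false :: r, hs, _ => left; simpa [Valid] using hs
    | [true], _, _ => right; simp [sv, dg]; nlinarith [beta_sq]
    | true :: false :: r, _, h => exact absurd rfl (h _)
    | true :: true :: r, hs, _ => simp [Valid] at hs

/-- digits sum -/
noncomputable def ds (z : ℝ) (n : ℕ) : ℝ := ∑ k ∈ Finset.range n, greedyDigit z k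

/-- Synchronisation: a valid stack followed by a small remainder is greedy. -/
lemma sync (s : List Bool) : ∀ (t z : ℝ), Valid s → 0 ≤ t → t < 1 →
    (s.head? = some true → t < 1 / β) → z * β ^ s.length = sv s + t →
    greedyT^[s.length] z = t ∧ ds z s.length = ones s := by
  induction s with
  | nil => intro t z _ _ _ _ h; simpa [ds, ones, sv] using h
  | cons b r ih =>
    intro t z hv h0 h1 hh hz
    have hb := beta_pos
    have hb' := beta_gt
    have hb2 := beta_sq
    have hvr : Valid r := by
      match b, r, hv with
      | false, r, hv => simpa [Valid] using hv
      | true, [], hv => simp [Valid]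
      | true, false :: r, hv => simpa [Valid] using hv
    have key := ih ((dg b + t) / β) z hvr (by unfold dg; split <;> positivity)
      (by
        rw [div_lt_one hb]
        cases b
        · simp [dg]; linarith
        · have := hh rfl
          rw [inv_beta] at this
          simp [dg]; linarith)
      (by
        intro hr
        cases b
        · simp [dg]; rw [← one_div]; gcongr
        · match r, hr with
          | true :: r, _ => simp [Valid] at hv)
      (by
        have e : z * β ^ r.length * β = sv (b :: r) + t := by
          rw [← hz, List.length_cons]; ring
        rw [eq_comm, ← sub_eq_zero]
        have e2 : (sv r + (dg b + t) / β - z * β ^ r.length) * β = 0 := by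
          rw [sub_mul, e, add_mul, div_mul_cancel₀ _ hb.ne']; simp [sv]; ring
        rcases mul_eq_zero.1 e2 with h | h
        · exact h
        · exact absurd h hb.ne')
    obtain ⟨k1, k2⟩ := key
    rw [List.length_cons]
    have hds : ds z (r.length + 1) = ones r + greedyDigit z r.length := by
      rw [ds, Finset.sum_range_succ, ← k2]; rfl
    rw [hds, Function.iterate_succ_apply', greedyDigit, k1]
    cases b
    · have : (dg false + t) / β < 1 / β := by simp [dg]; rw [← one_div]; gcongr
      rw [greedyT, if_pos this, if_neg (not_le.2 this)]
      constructor
      · simp [dg]; field_simp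
      · simp [ones]
    · have : 1 / β ≤ (dg true + t) / β := by gcongr; simp [dg]; exact h0
      rw [greedyT, if_neg (not_lt.2 this), if_pos this]
      constructor
      · simp [dg]; field_simp; ring
      · simp [ones]; ring

lemma digit_nonneg (z : ℝ) (k : ℕ) : 0 ≤ greedyDigit z k := by
  unfold greedyDigit; split <;> norm_num

lemma digit_le (z : ℝ) (k : ℕ) : greedyDigit z k ≤ 1 := by
  unfold greedyDigit; split <;> norm_num

/-- Merging of the orbit of `x` and `x / β`. -/
lemma merge (x : ℝ) (h0 : 0 ≤ x) (h1 : x < β) :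
    ∃ p, greedyT^[p] x = greedyT^[p + 1] (x / β) := by
  have hb := beta_pos
  have hb' := beta_gt
  have hb2 := beta_sq
  have hi := inv_beta
  by_cases hx : x < 1
  · refine ⟨0, ?_⟩
    simp [greedyT]
    rw [if_pos (by rw [← one_div]; gcongr)]; field_simp
  push Not at hx
  by_contra! hne
  have hz : greedyT (x / β) = x - 1 := by
    rw [greedyT, if_neg (by rw [not_lt]; gcongr)]; field_simp
  have claim : ∀ k : ℕ, 1 ≤ greedyT^[2 * k] x ∧ greedyT^[2 * k] x < β ∧
      greedyT^[2 * k + 1] (x / β) = greedyT^[2 * k] x - 1 ∧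
      β - greedyT^[2 * k] x = β ^ (2 * k) * (β - x) := by
    intro k
    induction k with
    | zero => simp [hz, hx, h1]
    | succ k ih =>
      obtain ⟨i1, i2, i3, i4⟩ := ih
      have hn := hne (2 * k + 2)
      rw [show 2 * (k + 1) = 2 * k + 1 + 1 by ring]
      rw [show 2 * k + 2 = 2 * k + 1 + 1 by ring] at hn
      simp only [Function.iterate_succ_apply' greedyT (2 * k + 1 + 1),
        Function.iterate_succ_apply' greedyT (2 * k + 1),
        Function.iterate_succ_apply' greedyT (2 * k)] at hn i3 ⊢
      rw [i3] at hn ⊢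
      set u := greedyT^[2 * k] x with hu
      have e1 : greedyT u = β * u - 1 := by
        rw [greedyT, if_neg]; rw [hi]; linarith [beta_lt]
      have e2 : greedyT (u - 1) = β * (u - 1) := by
        rw [greedyT, if_pos]; rw [hi]; linarith
      have e3 : greedyT (β * u - 1) = β * (β * u - 1) - 1 := by
        rw [greedyT, if_neg]; rw [hi]; nlinarith
      rw [e1, e2, e3] at hn ⊢
      have e4 : ¬ β * (u - 1) < 1 / β := by
        intro h
        apply hn
        rw [greedyT, if_pos h]
        linear_combination hb2
      have e5 : greedyT (β * (u - 1)) = β * (β * (u - 1)) - 1 := by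
        rw [greedyT, if_neg e4]
      rw [e5]
      rw [hi] at e4
      refine ⟨by nlinarith, by nlinarith, by linear_combination (-1) * hb2, ?_⟩
      rw [pow_succ, pow_succ]
      linear_combination β ^ 2 * i4 - (β + 1) * hb2
  have hlim : Tendsto (fun k : ℕ => (β ^ 2) ^ k * (β - x)) atTop atTop :=
    (tendsto_pow_atTop_atTop_of_one_lt (by nlinarith)).atTop_mul_const (by linarith)
  obtain ⟨k, hk⟩ := (hlim.eventually (eventually_gt_atTop β)).exists
  obtain ⟨i1, i2, i3, i4⟩ := claim k
  rw [pow_mul] at i4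
  linarith

/-- The tail value. -/
noncomputable def tl (a : ℕ → Fin 2) (n : ℕ) : ℝ := projPi (fun k => a (n + k))

lemma pi_term (n : ℕ) : β ^ (-((n : ℤ) + 1)) = β⁻¹ * (β⁻¹) ^ n := by
  have hb := beta_pos
  rw [zpow_neg, zpow_add_one₀ hb.ne', zpow_natCast]
  rw [mul_inv, inv_pow]; ring

lemma fin2_cast_le (b : Fin 2) : ((b : ℕ) : ℝ) ≤ 1 := by
  fin_cases b <;> simp

lemma geo_summable : Summable (fun n : ℕ => β⁻¹ * (β⁻¹) ^ n) := by
  apply Summable.mul_left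
  apply summable_geometric_of_lt_one (inv_nonneg.2 beta_pos.le)
  apply inv_lt_one_of_one_lt₀
  linarith [beta_gt]

lemma geo_tsum : ∑' n : ℕ, β⁻¹ * (β⁻¹) ^ n = β := by
  have hb := beta_gt
  have h1 : β⁻¹ < 1 := by apply inv_lt_one_of_one_lt₀; linarith
  rw [tsum_mul_left, tsum_geometric_of_lt_one (inv_nonneg.2 beta_pos.le) h1, ← mul_inv]
  have e : β * (1 - β⁻¹) = β⁻¹ := by
    rw [mul_sub, mul_inv_cancel₀ beta_pos.ne']
    rw [← one_div, inv_beta]; ring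
  rw [e, inv_inv]

lemma pi_summable (a : ℕ → Fin 2) :
    Summable (fun n : ℕ => (a n : ℝ) * β ^ (-((n : ℤ) + 1))) := by
  have hb := beta_pos
  refine Summable.of_nonneg_of_le (fun n => by positivity) (fun n => ?_) geo_summable
  rw [pi_term]
  have h0 : 0 ≤ β⁻¹ * (β⁻¹) ^ n := by positivity
  nlinarith [fin2_cast_le (a n)]

lemma pi_nonneg (a : ℕ → Fin 2) : 0 ≤ projPi a := by
  have hb := beta_pos
  exact tsum_nonneg (fun n => by positivity)

lemma pi_le (a : ℕ → Fin 2) : projPi a ≤ β := by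
  rw [← geo_tsum]
  refine (pi_summable a).tsum_le_tsum (fun n => ?_) geo_summable
  rw [pi_term]
  have hb := beta_pos
  have h0 : 0 ≤ β⁻¹ * (β⁻¹) ^ n := by positivity
  nlinarith [fin2_cast_le (a n)]

lemma tl_succ (a : ℕ → Fin 2) (n : ℕ) : tl a (n + 1) = β * tl a n - (a n : ℝ) := by
  have hb := beta_pos
  unfold tl
  rw [projPi, projPi, (pi_summable (fun k => a (n + k))).tsum_eq_zero_add]
  have : ∀ k : ℕ, (a (n + (k + 1)) : ℝ) * β ^ (-(((k + 1 : ℕ) : ℤ) + 1))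
      = β⁻¹ * ((a (n + 1 + k) : ℝ) * β ^ (-((k : ℤ) + 1))) := by
    intro k
    rw [pi_term, pi_term, show n + (k + 1) = n + 1 + k by ring, pow_succ]; ring
  simp only [this]
  rw [tsum_mul_left, mul_add, mul_inv_cancel_left₀ hb.ne']
  simp
  field_simp
  ring

lemma tl_zero (a : ℕ → Fin 2) : tl a 0 = projPi a := by simp [tl]

lemma tl_nonneg (a : ℕ → Fin 2) (n : ℕ) : 0 ≤ tl a n := pi_nonneg _

lemma tl_le (a : ℕ → Fin 2) (n : ℕ) : tl a n ≤ β := pi_le _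

/-- not eventually one -/
def Good (a : ℕ → Fin 2) : Prop := ∀ n, ∃ k, n ≤ k ∧ a k = 0

lemma tl_lt (a : ℕ → Fin 2) (ha : Good a) (n : ℕ) : tl a n < β := by
  by_contra h
  have hn : tl a n = β := le_antisymm (tl_le a n) (not_lt.1 h)
  have key : ∀ k, tl a (n + k) = β := by
    intro k
    induction k with
    | zero => exact hn
    | succ k ih =>
      have h1 := tl_succ a (n + k)
      rw [ih] at h1
      have h2 := fin2_cast_le (a (n + k))
      have h3 := tl_le a (n + k + 1)
      have := beta_sq
      rw [← add_assoc]
      apply le_antisymm h3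
      nlinarith
  obtain ⟨k, hk, h0⟩ := ha n
  obtain ⟨i, rfl⟩ := Nat.exists_eq_add_of_le hk
  have h1 := tl_succ a (n + i)
  have h3 := tl_le a (n + i + 1)
  rw [key i, h0] at h1
  have := beta_sq
  have := beta_gt
  simp at h1
  nlinarith

/-- Machine states. -/
structure MS where
  ph : Bool
  j : ℕ
  D : ℤ
  g : ℕ

/-- One step of the machine; `ph = true` means the last digit of the normal form is one. -/
def mstep (y : MS) (b : Fin 2) : MS :=
  if y.ph then
    (if b = 0 then ⟨false, y.j, y.D, y.g + 1⟩ else ⟨false, 0, y.D + 1 - y.j, y.g + 1⟩)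
  else
    (if b = 0 then ⟨false, 0, y.D, 1⟩ else ⟨true, y.j + 1, y.D + 1, y.g + 1⟩)

def mrun (a : ℕ → Fin 2) : ℕ → MS
  | 0 => ⟨false, 0, 0, 1⟩
  | n + 1 => mstep (mrun a n) (a n)

/-- Lyapunov function -/
noncomputable def lyap (n : ℕ) (y : MS) : ℝ :=
  ((y.D : ℝ) - 5 / 18 * n + (if y.ph then -2 / 3 * (y.j : ℝ) + 2 / 9 else -(1 / 3) * (y.j : ℝ))) ^ 2
    + (y.j : ℝ) ^ 2 + (if y.ph then 3 else 2) * (y.g : ℝ) ^ 2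

lemma lyap_nonneg (n : ℕ) (y : MS) : 0 ≤ lyap n y := by
  unfold lyap
  have : (0:ℝ) ≤ (if y.ph then 3 else 2) := by split <;> norm_num
  positivity

lemma lyap_drift (n : ℕ) (y : MS) :
    lyap (n + 1) (mstep y 0) + lyap (n + 1) (mstep y 1) ≤ 2 * (lyap n y + 10) := by
  obtain ⟨ph, j, D, g⟩ := y
  cases ph
  · simp [lyap, mstep]
    have hj : (0:ℝ) ≤ j := by positivity
    nlinarith [sq_nonneg ((j:ℝ) - 2), sq_nonneg ((g:ℝ) - 3), sq_nonneg ((j:ℝ) - 1)]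
  · simp [lyap, mstep]
    have hj : (0:ℝ) ≤ j := by positivity
    nlinarith [sq_nonneg ((j:ℝ) - 2), sq_nonneg ((g:ℝ) - 2), sq_nonneg ((j:ℝ) - 1)]

lemma lyap_lower (n : ℕ) (y : MS) :
    ((y.D : ℝ) - 5 / 18 * n) ^ 2 + (y.g : ℝ) ^ 2 ≤ 4 * lyap n y + 4 := by
  obtain ⟨ph, j, D, g⟩ := y
  have hj : (0:ℝ) ≤ j := by positivity
  cases ph
  · simp [lyap]
    set d := (D:ℝ) - 5 / 18 * n
    nlinarith [sq_nonneg (d + 2 * (-(3⁻¹ * (j:ℝ)))), sq_nonneg (g:ℝ)]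
  · simp [lyap]
    set d := (D:ℝ) - 5 / 18 * n
    nlinarith [sq_nonneg (d + 2 * (-2 / 3 * (j:ℝ) + 2 / 9)), sq_nonneg (g:ℝ), sq_nonneg ((j:ℝ) - 1)]

def stack (a : ℕ → Fin 2) : ℕ → List Bool
  | 0 => [false]
  | n + 1 => if a n = 0 then false :: stack a n else push1 (stack a n)

lemma stack_length (a : ℕ → Fin 2) (n : ℕ) : (stack a n).length = n + 1 := by
  induction n with
  | zero => rfl
  | succ n ih => rw [stack]; split <;> simp [push1_length, ih]

lemma fin2_ne {b : Fin 2} (h : b ≠ 0) : b = 1 := by omega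

lemma stack_sv (a : ℕ → Fin 2) (n : ℕ) :
    projPi a / β * β ^ (n + 1) = sv (stack a n) + tl a n := by
  have hb := beta_pos
  induction n with
  | zero => simp [stack, sv, dg, tl_zero]; field_simp
  | succ n ih =>
    rw [pow_succ, ← mul_assoc, ih, tl_succ, stack]
    split
    · rename_i h; rw [h]; simp [sv, dg]; ring
    · rename_i h; rw [fin2_ne h, sv_push1]; simp; ring

lemma stack_lt (a : ℕ → Fin 2) (ha : Good a) (n : ℕ) : sv (stack a n) < β ^ (n + 1) := by
  have h := stack_sv a n
  have hb := beta_pos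
  have h1 := tl_nonneg a n
  have h2 := tl_lt a ha 0
  rw [tl_zero] at h2
  have h3 : projPi a / β < 1 := by rwa [div_lt_one hb]
  have h4 : 0 < β ^ (n + 1) := by positivity
  nlinarith

lemma stack_valid (a : ℕ → Fin 2) (ha : Good a) (n : ℕ) : Valid (stack a n) := by
  induction n with
  | zero => simp [stack, Valid]
  | succ n ih =>
    have h := stack_lt a ha (n + 1)
    rw [stack] at h ⊢
    split
    · simpa [Valid] using ih
    · rename_i h0
      rw [if_neg h0] at h
      rcases valid_push1 _ ih with h1 | h1
      · exact h1
      · rw [stack_length] at h1; linarith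

lemma stack_match (a : ℕ → Fin 2) (n : ℕ) :
    ones (stack a n) = (mrun a n).D ∧
    (((mrun a n).ph = false ∧ ∃ s, stack a n = false :: s ∧ run s = (mrun a n).j) ∨
     ((mrun a n).ph = true ∧ ∃ s, stack a n = true :: false :: s ∧ run s + 1 = (mrun a n).j)) := by
  induction n with
  | zero => simp [stack, mrun, ones, run]
  | succ n ih =>
    obtain ⟨hD, ⟨hp, s, hs, hr⟩ | ⟨hp, s, hs, hr⟩⟩ := ih
    · rw [hs] at hD
      by_cases h : a n = 0
      · simp [stack, mrun, mstep, hp, h, hs, ← hD, ones, run]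
      · simp [stack, mrun, mstep, hp, h, hs, ← hD, ones, run, push1, hr]; ring
    · rw [hs] at hD
      by_cases h : a n = 0
      · simp [stack, mrun, mstep, hp, h, hs, ← hD, ones, run, hr]
      · simp [stack, mrun, mstep, hp, h, hs, ← hD, ones, run, push1, ← hr, ones_push1]; ring

lemma ds_succ (z : ℝ) (n : ℕ) : ds z (n + 1) = ds z n + greedyDigit z n := by
  simp [ds, Finset.sum_range_succ]

lemma bridge (a : ℕ → Fin 2) (ha : Good a) (n : ℕ) :
    ∃ q : ℝ, q ≤ (mrun a n).D - (mrun a n).j ∧ ((mrun a n).D : ℝ) ≤ q + (mrun a n).g ∧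
      q ≤ ds (projPi a / β) (n + 1) ∧ ds (projPi a / β) (n + 1) ≤ q + (mrun a n).g := by
  induction n with
  | zero =>
    refine ⟨0, ?_⟩
    simp [mrun, ds]
    exact ⟨digit_nonneg _ _, digit_le _ _⟩
  | succ n ih =>
    have hd0 := digit_nonneg (projPi a / β) (n + 1)
    have hd1 := digit_le (projPi a / β) (n + 1)
    obtain ⟨q, h1, h2, h3, h4⟩ := ih
    have hj : (0:ℝ) ≤ (mrun a n).j := by positivity
    rw [ds_succ]
    by_cases h : a n = 0
    · rcases hp : (mrun a n).ph with _ | _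
      · obtain ⟨hD, ⟨hp', s, hs, hr⟩ | ⟨hp', s, hs, hr⟩⟩ := stack_match a n
        · have ht : tl a n < 1 := by
            have e := tl_succ a n
            have l := tl_lt a ha (n + 1)
            have hb := beta_pos
            rw [h] at e
            simp at e
            nlinarith
          have sy := (sync (stack a n) (tl a n) (projPi a / β) (stack_valid a ha n)
            (tl_nonneg a n) ht (by rw [hs]; simp) (by rw [stack_length]; exact stack_sv a n)).2
          rw [stack_length, hD] at sy
          refine ⟨(mrun a n).D, ?_⟩
          simp only [mrun, mstep, hp, h, sy]
          simp
          exact ⟨hd0, hd1⟩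
        · rw [hp] at hp'; simp at hp'
      · refine ⟨q, ?_⟩
        simp [mrun, mstep, hp, h]
        refine ⟨?_, ?_, ?_, ?_⟩ <;> linarith
    · refine ⟨q, ?_⟩
      rcases hp : (mrun a n).ph with _ | _ <;> simp [mrun, mstep, hp, h] <;>
        refine ⟨?_, ?_, ?_, ?_⟩ <;> linarith

lemma ds_bound (a : ℕ → Fin 2) (ha : Good a) (n : ℕ) :
    (ds (projPi a / β) (n + 1) - 5 / 18 * n) ^ 2 ≤ 8 * lyap n (mrun a n) + 8 := by
  obtain ⟨q, h1, h2, h3, h4⟩ := bridge a ha n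
  have hl := lyap_lower n (mrun a n)
  have hj : (0:ℝ) ≤ (mrun a n).j := by positivity
  set S := ds (projPi a / β) (n + 1)
  set d : ℝ := ((mrun a n).D : ℝ)
  set g : ℝ := ((mrun a n).g : ℝ)
  have h5 : (S - d) ^ 2 ≤ g ^ 2 := by
    apply sq_le_sq'  <;> linarith
  nlinarith [sq_nonneg ((S - d) - (d - 5 / 18 * n))]

/-- extension of a finite word by zeros -/
def ext0 {n : ℕ} (w : Fin n → Fin 2) (i : ℕ) : Fin 2 := if h : i < n then w ⟨i, h⟩ else 0

lemma mrun_congr (a b : ℕ → Fin 2) (n : ℕ) (h : ∀ i < n, a i = b i) : mrun a n = mrun b n := by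
  induction n with
  | zero => rfl
  | succ n ih => rw [mrun, mrun, ih (fun i hi => h i (by omega)), h n (by omega)]

lemma sum_lyap (n : ℕ) :
    ∑ w : Fin n → Fin 2, lyap n (mrun (ext0 w) n) ≤ 2 ^ n * (2 + 10 * n) := by
  induction n with
  | zero => simp [lyap, mrun]
  | succ n ih =>
    rw [← (Fin.snocEquiv (fun _ : Fin (n + 1) => Fin 2)).sum_comp, Fintype.sum_prod_type_right]
    have e : ∀ (w : Fin n → Fin 2) (b : Fin 2),
        mrun (ext0 (Fin.snocEquiv (fun _ : Fin (n + 1) => Fin 2) (b, w))) (n + 1)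
          = mstep (mrun (ext0 w) n) b := by
      intro w b
      rw [mrun]
      congr 1
      · apply mrun_congr
        intro i hi
        simp [ext0, hi, Nat.lt_succ_of_lt hi, Fin.snocEquiv, Fin.snoc]
      · simp [ext0, Fin.snocEquiv, Fin.snoc]
    simp only [e, Fin.sum_univ_two]
    calc _ ≤ ∑ w : Fin n → Fin 2, 2 * (lyap n (mrun (ext0 w) n) + 10) :=
          Finset.sum_le_sum (fun w _ => lyap_drift n _)
      _ = 2 * (∑ w : Fin n → Fin 2, lyap n (mrun (ext0 w) n)) + 2 ^ n * 20 := by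
          rw [← Finset.mul_sum, Finset.sum_add_distrib]; simp; ring
      _ ≤ 2 * (2 ^ n * (2 + 10 * n)) + 2 ^ n * 20 := by gcongr
      _ = _ := by push_cast; ring

lemma lint_lyap (m : Measure (ℕ → Fin 2)) (hm : IsBernoulliHalf m) (n : ℕ) :
    Measurable (fun a => ENNReal.ofReal (lyap n (mrun a n))) ∧
    ∫⁻ a, ENNReal.ofReal (lyap n (mrun a n)) ∂m ≤ ENNReal.ofReal (2 + 10 * n) := by
  set ρ : (ℕ → Fin 2) → (Fin n → Fin 2) := fun a i => a i with hρ
  have hρm : Measurable ρ := by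
    apply measurable_pi_lambda
    intro i
    exact measurable_pi_apply _
  have e : (fun a : ℕ → Fin 2 => ENNReal.ofReal (lyap n (mrun a n))) =
      fun a => (fun w => ENNReal.ofReal (lyap n (mrun (ext0 w) n))) (ρ a) := by
    funext a
    have : mrun a n = mrun (ext0 (ρ a)) n := by
      apply mrun_congr
      intro i hi
      simp [ext0, hi, hρ]
    simp only [← this]
  rw [e]
  have hf : Measurable (fun w : Fin n → Fin 2 => ENNReal.ofReal (lyap n (mrun (ext0 w) n))) :=
    measurable_of_finite _
  refine ⟨hf.comp hρm, ?_⟩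
  rw [← lintegral_map hf hρm, lintegral_fintype]
  have hs : ∀ w : Fin n → Fin 2, (m.map ρ) {w} = (1 / 2 : ENNReal) ^ n := by
    intro w
    rw [Measure.map_apply hρm (measurableSet_singleton w)]
    have := hm.2 (Finset.range n) (ext0 w)
    rw [Finset.card_range] at this
    rw [← this]
    congr 1
    ext a
    simp only [Set.mem_preimage, Set.mem_singleton_iff, Set.mem_setOf_eq, Finset.mem_range]
    constructor
    · rintro rfl i hi
      simp [ext0, hi, hρ]
    · intro h
      funext i
      simp [hρ, h i i.2, ext0]
  simp only [hs]
  have h2 : (1 / 2 : ENNReal) ^ n = ENNReal.ofReal ((1 / 2) ^ n) := by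
    rw [ENNReal.ofReal_pow (by norm_num)]
    congr 1
    rw [ENNReal.ofReal_div_of_pos (by norm_num)]; simp
  rw [← Finset.sum_mul, h2, ← ENNReal.ofReal_sum_of_nonneg (fun w _ => lyap_nonneg _ _),
    ← ENNReal.ofReal_mul (Finset.sum_nonneg (fun w _ => lyap_nonneg _ _))]
  apply ENNReal.ofReal_le_ofReal
  calc _ ≤ (2 ^ n * (2 + 10 * n)) * (1 / 2 : ℝ) ^ n := by gcongr; exact sum_lyap n
    _ = ((2 : ℝ) * (1 / 2)) ^ n * (2 + 10 * n) := by rw [mul_pow]; ring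
    _ = _ := by norm_num

lemma ae_good (m : Measure (ℕ → Fin 2)) (hm : IsBernoulliHalf m) : ∀ᵐ a ∂m, Good a := by
  unfold Good
  rw [ae_all_iff]
  intro n
  rw [ae_iff]
  have key : ∀ k : ℕ, m {a | ¬ ∃ i, n ≤ i ∧ a i = 0} ≤ (1 / 2 : ENNReal) ^ k := by
    intro k
    have := hm.2 (Finset.Ico n (n + k)) (fun _ => 1)
    rw [Nat.card_Ico, Nat.add_sub_cancel_left] at this
    rw [← this]
    apply measure_mono
    intro a ha i hi
    simp only [Set.mem_setOf_eq, not_exists, not_and] at ha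
    exact fin2_ne (ha i (Finset.mem_Ico.1 hi).1)
  have hl : Tendsto (fun k : ℕ => (1 / 2 : ENNReal) ^ k) atTop (nhds 0) := by
    apply ENNReal.tendsto_pow_atTop_nhds_zero_of_lt_one
    simp
  exact le_antisymm (ge_of_tendsto' hl key) (zero_le)

lemma ae_lyap (m : Measure (ℕ → Fin 2)) (hm : IsBernoulliHalf m) :
    ∀ᵐ a ∂m, Tendsto (fun k : ℕ => lyap ((k + 1) ^ 2) (mrun a ((k + 1) ^ 2)) / ((k : ℝ) + 1) ^ 4)
      atTop (nhds 0) := by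
  set F : ℕ → (ℕ → Fin 2) → ENNReal := fun k a =>
    ENNReal.ofReal (1 / ((k : ℝ) + 1) ^ 4) *
      ENNReal.ofReal (lyap ((k + 1) ^ 2) (mrun a ((k + 1) ^ 2))) with hF
  have hmeas : ∀ k, Measurable (F k) := fun k => (lint_lyap m hm _).1.const_mul _
  have hint : ∀ k, ∫⁻ a, F k a ∂m ≤ ENNReal.ofReal (12 * (1 / ((k : ℝ) + 1) ^ 2)) := by
    intro k
    rw [hF, lintegral_const_mul _ (lint_lyap m hm _).1]
    refine (mul_le_mul_right (lint_lyap m hm ((k + 1) ^ 2)).2 _).trans ?_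
    rw [← ENNReal.ofReal_mul (by positivity)]
    apply ENNReal.ofReal_le_ofReal
    have hk : (0:ℝ) ≤ k := by positivity
    push_cast
    rw [mul_one_div, one_div_mul_eq_div, div_le_div_iff₀ (by positivity) (by positivity)]
    nlinarith [show (1:ℝ) ≤ (k + 1) ^ 2 by nlinarith, show (0:ℝ) ≤ ((k:ℝ) + 1) ^ 2 by positivity]
  have hsum : Summable (fun k : ℕ => 12 * (1 / ((k : ℝ) + 1) ^ 2)) := by
    apply Summable.mul_left
    have := (summable_nat_add_iff 1).2 (Real.summable_one_div_nat_pow.2 (show 1 < 2 by norm_num))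
    simpa using this
  have htot : ∫⁻ a, ∑' k, F k a ∂m ≠ ⊤ := by
    rw [lintegral_tsum (fun k => (hmeas k).aemeasurable)]
    exact ((ENNReal.tsum_le_tsum hint).trans_lt hsum.tsum_ofReal_lt_top).ne
  filter_upwards [ae_lt_top (Measurable.ennreal_tsum hmeas) htot] with a ha
  have h0 := ENNReal.tendsto_cofinite_zero_of_tsum_ne_top ha.ne
  rw [Nat.cofinite_eq_atTop] at h0
  have h1 := (ENNReal.tendsto_toReal ENNReal.zero_ne_top).comp h0
  simp only [ENNReal.toReal_zero] at h1
  refine h1.congr (fun k => ?_)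
  simp only [Function.comp, hF]
  rw [ENNReal.toReal_mul, ENNReal.toReal_ofReal (by positivity),
    ENNReal.toReal_ofReal (lyap_nonneg _ _)]
  ring

lemma ds_mono (z : ℝ) : Monotone (ds z) :=
  monotone_nat_of_le_succ (fun n => by rw [ds_succ]; linarith [digit_nonneg z n])

lemma ds_tendsto (a : ℕ → Fin 2) (ha : Good a)
    (h : Tendsto (fun k : ℕ => lyap ((k + 1) ^ 2) (mrun a ((k + 1) ^ 2)) / ((k : ℝ) + 1) ^ 4)
      atTop (nhds 0)) :
    Tendsto (fun n : ℕ => ds (projPi a / β) (n + 1) / n) atTop (nhds (5 / 18)) := by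
  apply tendsto_div_of_monotone_of_exists_subseq_tendsto_div
    (fun n => ds (projPi a / β) (n + 1)) (5 / 18)
    (fun i j hij => ds_mono _ (by omega))
  intro c hc
  refine ⟨fun k => (k + 1) ^ 2, ?_, ?_, ?_⟩
  · have ev : ∀ᶠ k : ℕ in atTop, 3 / (c - 1) ≤ (k : ℝ) :=
      tendsto_natCast_atTop_atTop.eventually_ge_atTop _
    filter_upwards [ev] with k hk
    rw [div_le_iff₀ (by linarith)] at hk
    push_cast
    have : (0:ℝ) ≤ k := by positivity
    nlinarith
  · exact (tendsto_pow_atTop (by norm_num)).comp (tendsto_add_atTop_nat 1)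
  · have hz : Tendsto (fun k : ℕ => 8 * (lyap ((k + 1) ^ 2) (mrun a ((k + 1) ^ 2)) /
        ((k : ℝ) + 1) ^ 4) + 8 * ((1 / ((k : ℝ) + 1)) ^ 4)) atTop (nhds 0) := by
      have := (h.const_mul 8).add ((tendsto_one_div_add_atTop_nhds_zero_nat (𝕜 := ℝ)).pow 4
        |>.const_mul 8)
      simpa using this
    have hsq : Tendsto (fun k : ℕ => (ds (projPi a / β) ((k + 1) ^ 2 + 1) /
        (((k + 1) ^ 2 : ℕ) : ℝ) - 5 / 18) ^ 2) atTop (nhds 0) := by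
      refine squeeze_zero (fun k => sq_nonneg _) (fun k => ?_) hz
      have hb := ds_bound a ha ((k + 1) ^ 2)
      have hk : (0:ℝ) < (k:ℝ) + 1 := by positivity
      push_cast at hb ⊢
      have e1 : ds (projPi a / β) ((k + 1) ^ 2 + 1) / ((k:ℝ) + 1) ^ 2 - 5 / 18 =
          (ds (projPi a / β) ((k + 1) ^ 2 + 1) - 5 / 18 * ((k:ℝ) + 1) ^ 2) / ((k:ℝ) + 1) ^ 2 := by
        field_simp
      rw [e1, div_pow, ← pow_mul, div_pow, one_pow, ← mul_div_assoc, ← mul_div_assoc, ← add_div]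
      norm_num
      gcongr
    rw [← tendsto_sub_nhds_zero_iff, tendsto_zero_iff_abs_tendsto_zero]
    have := hsq.sqrt
    simpa [Real.sqrt_sq_eq_abs, Function.comp_def] using this

lemma digit_shift (x z : ℝ) (p : ℕ) (h : greedyT^[p] x = greedyT^[p + 1] z) (k : ℕ) :
    greedyDigit x (p + k) = greedyDigit z (p + k + 1) := by
  have e : greedyT^[p + k] x = greedyT^[p + k + 1] z := by
    rw [show p + k = k + p by ring, Function.iterate_add_apply, h, ← Function.iterate_add_apply]
    rfl
  rw [greedyDigit, greedyDigit, e]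

lemma ds_shift (x z : ℝ) (p : ℕ) (h : greedyT^[p] x = greedyT^[p + 1] z) (k : ℕ) :
    ds x (p + k) = ds z (p + k + 1) + (ds x p - ds z (p + 1)) := by
  induction k with
  | zero => simp
  | succ k ih =>
    rw [← add_assoc, ds_succ, ih, digit_shift x z p h, ds_succ z (p + k + 1)]; ring

end GoldenFreq

open GoldenFreq

theorem bernoulli_ae_digit_frequency (m : Measure (ℕ → Fin 2))
    (hm : IsBernoulliHalf m) :
    ∀ᵐ a ∂m,
      Tendsto (fun N : ℕ => (∑ n ∈ Finset.range N, greedyDigit (projPi a) n) / N)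
        atTop (nhds (5 / 18)) := by
  filter_upwards [ae_good m hm, ae_lyap m hm] with a ha hl
  have h := ds_tendsto a ha hl
  have hlt := tl_lt a ha 0
  rw [tl_zero] at hlt
  obtain ⟨p, hp⟩ := merge (projPi a) (pi_nonneg a) hlt
  set C := ds (projPi a) p - ds (projPi a / goldenMean) (p + 1) with hC
  have hc : Tendsto (fun n : ℕ => C / (n : ℝ)) atTop (nhds 0) :=
    tendsto_const_div_atTop_nhds_zero_nat C
  have := h.add hc
  rw [add_zero] at this
  refine this.congr' ?_
  filter_upwards [eventually_ge_atTop p] with n hn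
  obtain ⟨k, rfl⟩ := Nat.exists_eq_add_of_le hn
  rw [← add_div, hC, ← ds_shift _ _ p hp k]
  rfl
end

section
/- Let β = (1+√5)/2 and let ν_β = m ∘ π^{-1} be the golden mean Bernoulli convolution. Then ν_β is supported on the set A_{5/18} of points whose greedy β-expansion has digit 1 with frequency 5/18, while Lebesgue measure is supported on A_{1/(β²+1)}; since 5/18 ≠ 1/(β²+1), ν_β is singular with respect to Lebesgue measure. -/
open MeasureTheory Filter

/-- The set of points of `[0, 1/(β-1)]` whose greedy β-expansion has digit 1 with
limiting frequency γ. -/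
noncomputable def freqSet (γ : ℝ) : Set ℝ :=
  {x ∈ Set.Icc (0 : ℝ) (1 / (goldenMean - 1)) |
    Tendsto (fun N : ℕ => (∑ k ∈ Finset.range N, greedyDigit x k) / N)
      atTop (nhds γ)}


/-- Bounded increments and convergence along squares. -/
theorem tendsto_of_squares (s : ℕ → ℝ) (hs : ∀ n, |s (n + 1) - s n| ≤ 1)
    (h : Tendsto (fun k : ℕ => s (k ^ 2) / (k : ℝ) ^ 2) atTop (nhds 0)) :
    Tendsto (fun n : ℕ => s n / n) atTop (nhds 0) := by
  have hinc : ∀ n j, |s (n + j) - s n| ≤ j := by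
    intro n j
    induction j with
    | zero => simp
    | succ j ih =>
      have := hs (n + j)
      have e : s (n + (j + 1)) - s n = (s (n + j + 1) - s (n + j)) + (s (n + j) - s n) := by
        rw [← add_assoc]; ring
      rw [e]
      push_cast
      linarith [abs_add_le (s (n + j + 1) - s (n + j)) (s (n + j) - s n)]
  have hsqrt : Tendsto Nat.sqrt atTop atTop := by
    refine tendsto_atTop_atTop.2 fun b => ⟨b * b, fun a ha => Nat.le_sqrt.2 ha⟩
  have h1 := (h.comp hsqrt).abs
  have h2 : Tendsto (fun n : ℕ => 2 / ((Nat.sqrt n : ℕ) : ℝ)) atTop (nhds 0) :=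
    (tendsto_const_nhds.div_atTop tendsto_natCast_atTop_atTop).comp hsqrt
  have h3 := h1.add h2
  rw [abs_zero, add_zero] at h3
  refine squeeze_zero_norm' ?_ h3
  filter_upwards [eventually_ge_atTop 1] with n hn
  have hk : 1 ≤ Nat.sqrt n := Nat.le_sqrt.2 (by simpa using hn)
  have hk1 : Nat.sqrt n ^ 2 ≤ n := Nat.sqrt_le' n
  have hk2 : n ≤ Nat.sqrt n * Nat.sqrt n + Nat.sqrt n + Nat.sqrt n := Nat.sqrt_le_add n
  obtain ⟨j, hj⟩ := Nat.exists_eq_add_of_le hk1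
  set k := Nat.sqrt n
  have hj2 : j ≤ 2 * k := by nlinarith
  have h4 := hinc (k ^ 2) j
  rw [← hj] at h4
  have hkr : (1 : ℝ) ≤ k := by exact_mod_cast hk
  have hjr : (j : ℝ) ≤ 2 * k := by exact_mod_cast hj2
  have hnr : (k : ℝ) ^ 2 ≤ n := by exact_mod_cast hk1
  simp only [Function.comp]
  rw [Real.norm_eq_abs, abs_div, abs_div, Nat.abs_cast, abs_of_nonneg (by positivity : (0:ℝ) ≤ (k:ℝ) ^ 2)]
  have h5 : |s n| ≤ |s (k ^ 2)| + 2 * k := by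
    have := abs_add_le (s n - s (k ^ 2)) (s (k ^ 2))
    rw [sub_add_cancel] at this
    linarith
  calc |s n| / n ≤ (|s (k ^ 2)| + 2 * k) / (k : ℝ) ^ 2 := by gcongr
    _ = |s (k ^ 2)| / (k : ℝ) ^ 2 + 2 / k := by field_simp

theorem ae_tendsto_of_sq_bound (μ : Measure ℝ) [IsFiniteMeasure μ] (f : ℕ → ℝ → ℝ)
    (hf : ∀ n, Measurable (f n)) (C : ℝ) (hfi : ∀ n, Integrable (fun x => f n x ^ 2) μ)
    (hC : ∀ n : ℕ, ∫ x, f n x ^ 2 ∂μ ≤ C * n)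
    (hb : ∀ x n, |f (n + 1) x - f n x| ≤ 1) :
    ∀ᵐ x ∂μ, Tendsto (fun n : ℕ => f n x / n) atTop (nhds 0) := by
  have hC0 : 0 ≤ C := by
    have := hC 1
    have h2 : 0 ≤ ∫ x, f 1 x ^ 2 ∂μ := integral_nonneg fun x => sq_nonneg _
    simp at this; linarith
  have hsum : ∑' k : ℕ, ∫⁻ x, ENNReal.ofReal ((f (k ^ 2) x / (k : ℝ) ^ 2) ^ 2) ∂μ ≠ ⊤ := by
    have hs : Summable (fun k : ℕ => C * (1 / (k : ℝ) ^ 2)) :=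
      (Real.summable_one_div_nat_pow.2 (by norm_num)).mul_left C
    refine ne_top_of_le_ne_top hs.tsum_ofReal_ne_top (ENNReal.tsum_le_tsum fun k => ?_)
    have e : ∀ x, (f (k ^ 2) x / (k : ℝ) ^ 2) ^ 2 = (1 / (k:ℝ) ^ 2) ^ 2 * f (k ^ 2) x ^ 2 := by
      intro x; ring
    simp_rw [e]
    rw [← ofReal_integral_eq_lintegral_ofReal ((hfi _).const_mul _)
      (ae_of_all _ fun x => by positivity), integral_const_mul]
    apply ENNReal.ofReal_le_ofReal
    have := hC (k ^ 2)
    push_cast at this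
    rcases Nat.eq_zero_or_pos k with rfl | hk
    · simp
    · have hk' : (0:ℝ) < k := by exact_mod_cast hk
      calc (1 / (k:ℝ) ^ 2) ^ 2 * ∫ x, f (k ^ 2) x ^ 2 ∂μ ≤ (1 / (k:ℝ) ^ 2) ^ 2 * (C * (k:ℝ) ^ 2) := by gcongr
        _ = _ := by field_simp
  rw [← lintegral_tsum (fun k => by have := hf (k ^ 2); fun_prop)] at hsum
  have hae := ae_lt_top (Measurable.tsum fun k => by have := hf (k ^ 2); fun_prop) hsum
  filter_upwards [hae] with x hx
  apply tendsto_of_squares _ (hb x)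
  have h1 := ENNReal.tendsto_atTop_zero_of_tsum_ne_top hx.ne
  have h2 := (ENNReal.tendsto_toReal ENNReal.zero_ne_top).comp h1
  have h3 : Tendsto (fun k : ℕ => (f (k ^ 2) x / (k : ℝ) ^ 2) ^ 2) atTop (nhds 0) := by
    refine h2.congr fun k => ?_
    simp only [Function.comp]
    rw [ENNReal.toReal_ofReal (sq_nonneg _)]
  have h4 := h3.sqrt
  simp only [Real.sqrt_sq_eq_abs, Real.sqrt_zero] at h4
  exact (tendsto_zero_iff_abs_tendsto_zero _).2 h4

/-- Partial sums along the orbit. -/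
noncomputable def orbSum (S c : ℝ → ℝ) (n : ℕ) (x : ℝ) : ℝ := ∑ k ∈ Finset.range n, c (S^[k] x)

theorem orbSum_succ (S c : ℝ → ℝ) (n : ℕ) (x : ℝ) :
    orbSum S c (n + 1) x = c x + orbSum S c n (S x) := by
  unfold orbSum
  rw [Finset.sum_range_succ']
  simp [add_comm]

theorem orbSum_measurable {S c : ℝ → ℝ} (hS : Measurable S) (hc : Measurable c) (n : ℕ) :
    Measurable (orbSum S c n) := by
  unfold orbSum
  exact Finset.measurable_sum _ fun k _ => hc.comp (hS.iterate k)

theorem orbSum_bound {S c : ℝ → ℝ} (hc : ∀ x, |c x| ≤ 1) (n : ℕ) (x : ℝ) :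
    |orbSum S c n x| ≤ n := by
  unfold orbSum
  refine (Finset.abs_sum_le_sum_abs _ _).trans ?_
  refine (Finset.sum_le_sum fun k _ => hc _).trans ?_
  simp

theorem integrable_of_meas_bdd {μ : Measure ℝ} [IsFiniteMeasure μ] {f : ℝ → ℝ}
    (hf : Measurable f) (C : ℝ) (hC : ∀ x, |f x| ≤ C) : Integrable f μ :=
  Integrable.of_bound hf.aestronglyMeasurable C (ae_of_all _ hC)

theorem block_lln {V : Type*} (μ : V → Measure ℝ) [∀ v, IsFiniteMeasure (μ v)]
    (S : ℝ → ℝ) (hS : Measurable S) (D : Set ℝ) (hD : MeasurableSet D)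
    (c : ℝ → ℝ) (hcm : Measurable c) (hc : ∀ x, |c x| ≤ 1)
    (c0 c1 : ℝ) (hc0 : ∀ x ∈ Dᶜ, c x = c0) (hc1 : ∀ x ∈ D, c x = c1)
    (hc0' : |c0| ≤ 1) (hc1' : |c1| ≤ 1)
    (M0 M1 : V → V)
    (h0 : ∀ v, ((μ v).restrict Dᶜ).map S = μ (M0 v))
    (h1 : ∀ v, ((μ v).restrict D).map S = μ (M1 v))
    (g : V → ℝ) (K : ℝ) (hg : ∀ v, |g v| ≤ K * (μ v).real Set.univ)
    (hP : ∀ v, g (M0 v) + g (M1 v) + c0 * (μ (M0 v)).real Set.univ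
      + c1 * (μ (M1 v)).real Set.univ = g v) (v : V) :
    ∀ᵐ x ∂μ v, Tendsto (fun n : ℕ => orbSum S c n x / n) atTop (nhds 0) := by
  have hK : ∀ v, 0 ≤ K * (μ v).real Set.univ := fun v => (abs_nonneg _).trans (hg v)
  have hm : ∀ n, Measurable (orbSum S c n) := orbSum_measurable hS hcm
  have hint : ∀ n v, Integrable (orbSum S c n) (μ v) := fun n v =>
    integrable_of_meas_bdd (hm n) n (orbSum_bound hc n)
  have hint2 : ∀ n v, Integrable (fun x => orbSum S c n x ^ 2) (μ v) := fun n v => by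
    refine integrable_of_meas_bdd ((hm n).pow_const 2) ((n : ℝ) ^ 2) fun x => ?_
    rw [abs_pow]
    exact pow_le_pow_left₀ (abs_nonneg _) (orbSum_bound hc n x) 2
  -- the basic recursion
  have rec' : ∀ (φ : ℝ → ℝ) (_ : Measurable φ) (n : ℕ) (v : V)
      (_ : Integrable (fun x => φ (orbSum S c (n + 1) x)) (μ v)),
      ∫ x, φ (orbSum S c (n + 1) x) ∂μ v =
        ∫ x, φ (c0 + orbSum S c n x) ∂μ (M0 v) + ∫ x, φ (c1 + orbSum S c n x) ∂μ (M1 v) := by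
    intro φ hφ n v hi
    rw [← h0, ← h1, integral_map hS.aemeasurable, integral_map hS.aemeasurable,
      ← integral_add_compl hD hi, add_comm]
    · congr 1
      · refine setIntegral_congr_fun hD.compl fun x hx => ?_
        simp only [orbSum_succ, hc0 x hx]
      · refine setIntegral_congr_fun hD fun x hx => ?_
        simp only [orbSum_succ, hc1 x hx]
    · exact (hφ.comp ((hm n).const_add c1)).aestronglyMeasurable
    · exact (hφ.comp ((hm n).const_add c0)).aestronglyMeasurable
  have mass : ∀ v, (μ (M0 v)).real Set.univ + (μ (M1 v)).real Set.univ = (μ v).real Set.univ := by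
    intro v
    rw [← h0, ← h1, map_measureReal_apply hS MeasurableSet.univ,
      map_measureReal_apply hS MeasurableSet.univ]
    simp only [Set.preimage_univ, measureReal_restrict_apply MeasurableSet.univ, Set.univ_inter]
    rw [add_comm, measureReal_add_measureReal_compl hD]
  have A : ∀ n v, |∫ x, orbSum S c n x ∂μ v - g v| ≤ K * (μ v).real Set.univ := by
    intro n
    induction n with
    | zero => intro v; simpa [orbSum] using hg v
    | succ n ih =>
      intro v
      have := rec' id measurable_id n v (hint _ _)
      simp only [id] at this
      rw [this, integral_add (integrable_const _) (hint _ _),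
        integral_add (integrable_const _) (hint _ _)]
      simp only [integral_const, smul_eq_mul]
      have e := hP v
      have i0 := abs_le.1 (ih (M0 v))
      have i1 := abs_le.1 (ih (M1 v))
      rw [← mass v, mul_add, abs_le]
      constructor <;> nlinarith
  have B : ∀ n v, ∫ x, orbSum S c n x ^ 2 ∂μ v ≤ ((1 + 4 * K) * (μ v).real Set.univ) * n := by
    intro n
    induction n with
    | zero => intro v; simp [orbSum]
    | succ n ih =>
      intro v
      rw [rec' (fun t => t ^ 2) (by fun_prop) n v (hint2 _ _)]
      have key : ∀ (d : ℝ) (w : V), |d| ≤ 1 → ∫ x, (d + orbSum S c n x) ^ 2 ∂μ w ≤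
          ((1 + 4 * K) * (μ w).real Set.univ) * (n + 1) := by
        intro d w hd
        have e : ∀ x, (d + orbSum S c n x) ^ 2 =
          (d ^ 2 + 2 * d * orbSum S c n x) + orbSum S c n x ^ 2 := fun x => by ring
        simp_rw [e]
        have ia : Integrable (fun x => d ^ 2 + 2 * d * orbSum S c n x) (μ w) :=
          (integrable_const _).add ((hint n w).const_mul _)
        rw [integral_add ia (hint2 n w),
          integral_add (integrable_const _) ((hint n w).const_mul _), integral_const_mul]
        simp only [integral_const, smul_eq_mul]
        have i1 := ih w
        have i2 : |∫ x, orbSum S c n x ∂μ w| ≤ 2 * (K * (μ w).real Set.univ) := by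
          have a := A n w
          have b := hg w
          have := abs_add_le (∫ x, orbSum S c n x ∂μ w - g w) (g w)
          rw [sub_add_cancel] at this
          linarith
        have i3 : d * ∫ x, orbSum S c n x ∂μ w ≤ 2 * (K * (μ w).real Set.univ) := by
          refine (le_abs_self _).trans ?_
          rw [abs_mul]
          calc _ ≤ 1 * (2 * (K * (μ w).real Set.univ)) := by
                gcongr
            _ = _ := one_mul _
        have i4 : (μ w).real Set.univ * d ^ 2 ≤ (μ w).real Set.univ := by
          have : d ^ 2 ≤ 1 := by rw [← sq_abs]; nlinarith [abs_nonneg d]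
          have h0 : 0 ≤ (μ w).real Set.univ := measureReal_nonneg
          nlinarith
        nlinarith
      have k0 := key c0 (M0 v) hc0'
      have k1 := key c1 (M1 v) hc1'
      rw [← mass v]
      push_cast
      nlinarith
  refine ae_tendsto_of_sq_bound (μ v) (fun n => orbSum S c n) hm _ (fun n => hint2 n v)
    (fun n => B n v) ?_
  intro x n
  unfold orbSum
  rw [Finset.sum_range_succ, add_sub_cancel_left]
  exact hc _
theorem gm_sq : goldenMean ^ 2 = goldenMean + 1 := by
  have h : Real.sqrt 5 ^ 2 = 5 := Real.sq_sqrt (by norm_num)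
  unfold goldenMean
  nlinarith

theorem gm_gt : 1 < goldenMean := by
  have h : (1:ℝ) < Real.sqrt 5 := by
    rw [Real.lt_sqrt] <;> norm_num
  unfold goldenMean
  linarith

theorem gm_gt' : 1.618 < goldenMean := by
  have h : (2.236:ℝ) < Real.sqrt 5 := by
    rw [Real.lt_sqrt] <;> norm_num
  unfold goldenMean
  linarith

theorem gm_lt : goldenMean < 1.6181 := by
  have h : Real.sqrt 5 < 2.2362 := by
    rw [Real.sqrt_lt'] <;> norm_num
  unfold goldenMean
  linarith

theorem gm_pos : 0 < goldenMean := by linarith [gm_gt]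

theorem gm_inv : 1 / goldenMean = goldenMean - 1 := by
  have := gm_sq
  have := gm_pos
  rw [div_eq_iff (by positivity)]
  nlinarith

theorem gm_inv' : 1 / (goldenMean - 1) = goldenMean := by
  rw [← gm_inv, one_div_one_div]

theorem gm_inv2 : 1 / (goldenMean ^ 2 + 1) ≤ 1 := by
  rw [div_le_one (by positivity)]
  nlinarith [sq_nonneg goldenMean]

/-- The induced block map. -/
noncomputable def blockS (x : ℝ) : ℝ :=
  if x < 1 / goldenMean then goldenMean * x else goldenMean ^ 2 * x - goldenMean

/-- The block cost. -/
noncomputable def blockC (γ : ℝ) (x : ℝ) : ℝ :=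
  if x < 1 / goldenMean then -γ else 1 - 2 * γ

theorem measurable_blockS : Measurable blockS := by
  unfold blockS
  exact Measurable.ite measurableSet_Iio (by fun_prop) (by fun_prop)

theorem measurable_blockC (γ : ℝ) : Measurable (blockC γ) := by
  unfold blockC
  exact Measurable.ite measurableSet_Iio (by fun_prop) (by fun_prop)

theorem blockS_mem {x : ℝ} (hx : x ∈ Set.Ico (0:ℝ) 1) : blockS x ∈ Set.Ico (0:ℝ) 1 := by
  have h1 := gm_sq
  have h2 := gm_gt
  obtain ⟨hx0, hx1⟩ := hx
  unfold blockS
  rw [gm_inv]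
  split_ifs with h
  · constructor <;> nlinarith
  · push Not at h
    rw [h1]
    constructor <;> nlinarith

theorem greedyDigit_succ (x : ℝ) (k : ℕ) : greedyDigit x (k + 1) = greedyDigit (greedyT x) k := by
  unfold greedyDigit
  rw [Function.iterate_succ_apply]

/-- Centred digit sums. -/
noncomputable def digSum (γ : ℝ) (N : ℕ) (x : ℝ) : ℝ :=
  ∑ k ∈ Finset.range N, (greedyDigit x k - γ)

theorem digSum_succ (γ : ℝ) (N : ℕ) (x : ℝ) :
    digSum γ (N + 1) x = (greedyDigit x 0 - γ) + digSum γ N (greedyT x) := by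
  unfold digSum
  rw [Finset.sum_range_succ']
  simp only [greedyDigit_succ]
  ring

theorem digit_zero_of_lt {x : ℝ} (h : x < 1 / goldenMean) :
    greedyDigit x 0 = 0 ∧ greedyT x = goldenMean * x := by
  constructor
  · exact if_neg (not_le.2 h)
  · rw [greedyT, if_pos h]

theorem digit_zero_of_ge {x : ℝ} (h : 1 / goldenMean ≤ x) :
    greedyDigit x 0 = 1 ∧ greedyT x = goldenMean * x - 1 := by
  constructor
  · exact if_pos h
  · rw [greedyT, if_neg (not_lt.2 h)]

theorem exists_block (γ : ℝ) (h0 : 0 ≤ γ) (h1 : γ ≤ 1) (N : ℕ) :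
    ∀ x ∈ Set.Ico (0:ℝ) 1, ∃ n ≤ N, |digSum γ N x - orbSum blockS (blockC γ) n x| ≤ 1 := by
  induction N using Nat.strong_induction_on with
  | _ N ih =>
    intro x hx
    rcases N with _ | N
    · exact ⟨0, le_rfl, by simp [digSum, orbSum]⟩
    · by_cases h : x < 1 / goldenMean
      · obtain ⟨n, hn, hb⟩ := ih N (by omega) _ (blockS_mem hx)
        refine ⟨n + 1, by omega, ?_⟩
        rw [orbSum_succ, digSum_succ, (digit_zero_of_lt h).1, (digit_zero_of_lt h).2]
        have e1 : blockS x = goldenMean * x := by rw [blockS, if_pos h]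
        have e2 : blockC γ x = -γ := by rw [blockC, if_pos h]
        rw [e2, ← e1]
        convert hb using 2
        ring
      · have h' := not_lt.1 h
        rcases N with _ | N
        · refine ⟨0, by omega, ?_⟩
          rw [digSum_succ, (digit_zero_of_ge h').1]
          simp only [digSum, orbSum, Finset.range_zero, Finset.sum_empty]
          rw [abs_le]; constructor <;> linarith
        · obtain ⟨n, hn, hb⟩ := ih N (by omega) _ (blockS_mem hx)
          refine ⟨n + 1, by omega, ?_⟩
          have h2 : greedyT x < 1 / goldenMean := by
            rw [(digit_zero_of_ge h').2, gm_inv]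
            nlinarith [hx.2, gm_pos]
          rw [orbSum_succ, digSum_succ, digSum_succ, (digit_zero_of_ge h').1,
            (digit_zero_of_lt h2).1, (digit_zero_of_lt h2).2, (digit_zero_of_ge h').2]
          have e1 : blockS x = goldenMean * (goldenMean * x - 1) := by
            rw [blockS, if_neg h]; ring
          have e2 : blockC γ x = 1 - 2 * γ := by rw [blockC, if_neg h]
          rw [e2, ← e1]
          convert hb using 2
          ring

/-- The frequency property. -/
def HasFreq (γ x : ℝ) : Prop :=
  Tendsto (fun N : ℕ => (∑ k ∈ Finset.range N, greedyDigit x k) / N) atTop (nhds γ)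

theorem hasFreq_iff (γ x : ℝ) :
    HasFreq γ x ↔ Tendsto (fun N : ℕ => digSum γ N x / N) atTop (nhds 0) := by
  unfold HasFreq
  rw [← tendsto_sub_nhds_zero_iff]
  apply tendsto_congr'
  filter_upwards [eventually_ge_atTop 1] with N hN
  have : (0:ℝ) < N := by exact_mod_cast hN
  unfold digSum
  rw [Finset.sum_sub_distrib]
  simp
  field_simp

theorem hasFreq_of_block {γ : ℝ} (h0 : 0 ≤ γ) (h1 : γ ≤ 1) {x : ℝ} (hx : x ∈ Set.Ico (0:ℝ) 1)
    (h : Tendsto (fun n : ℕ => orbSum blockS (blockC γ) n x / n) atTop (nhds 0)) :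
    HasFreq γ x := by
  rw [hasFreq_iff]
  have hbd : ∀ ε > 0, ∃ K : ℝ, ∀ n : ℕ, |orbSum blockS (blockC γ) n x| ≤ ε * n + K := by
    intro ε hε
    have h2 := (Metric.tendsto_atTop.1 h) ε hε
    obtain ⟨n0, hn0⟩ := h2
    refine ⟨∑ k ∈ Finset.range (n0 + 1), |orbSum blockS (blockC γ) k x|, fun n => ?_⟩
    have hs : 0 ≤ ∑ k ∈ Finset.range (n0 + 1), |orbSum blockS (blockC γ) k x| :=
      Finset.sum_nonneg fun _ _ => abs_nonneg _
    by_cases hn : n ≤ n0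
    · have := Finset.single_le_sum (f := fun k => |orbSum blockS (blockC γ) k x|)
        (fun _ _ => abs_nonneg _) (Finset.mem_range.2 (Nat.lt_succ_of_le hn))
      have h3 : 0 ≤ ε * n := by positivity
      linarith
    · have hp : (0:ℝ) < n := by exact_mod_cast (by omega : 0 < n)
      have := hn0 n (by omega)
      rw [Real.dist_eq, sub_zero, abs_div, Nat.abs_cast, div_lt_iff₀ hp] at this
      linarith
  rw [Metric.tendsto_atTop]
  intro ε hε
  obtain ⟨K, hK⟩ := hbd (ε / 2) (by positivity)
  obtain ⟨N0, hN0⟩ := exists_nat_gt ((|K| + 1) / (ε / 2))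
  refine ⟨N0 + 1, fun N hN => ?_⟩
  have hp : (0:ℝ) < N := by exact_mod_cast (by omega : 0 < N)
  rw [Real.dist_eq, sub_zero, abs_div, Nat.abs_cast, div_lt_iff₀ hp]
  obtain ⟨n, hn, hb⟩ := exists_block γ h0 h1 N x hx
  have hn' : (n:ℝ) ≤ N := by exact_mod_cast hn
  have hN' : (N0:ℝ) ≤ N := by exact_mod_cast (by omega : N0 ≤ N)
  rw [div_lt_iff₀ (by positivity)] at hN0
  have h3 := hK n
  have h4 := abs_add_le (digSum γ N x - orbSum blockS (blockC γ) n x) (orbSum blockS (blockC γ) n x)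
  rw [sub_add_cancel] at h4
  have h5 := le_abs_self K
  nlinarith

theorem hasFreq_of_T {γ x : ℝ} (h : HasFreq γ (greedyT x)) : HasFreq γ x := by
  rw [hasFreq_iff] at *
  rw [← tendsto_add_atTop_iff_nat 1]
  have h1 : Tendsto (fun N : ℕ => (greedyDigit x 0 - γ) / ((N:ℝ) + 1)) atTop (nhds 0) :=
    tendsto_const_nhds.div_atTop
      (tendsto_atTop_add_const_right _ _ tendsto_natCast_atTop_atTop)
  have h2 := h.mul (tendsto_natCast_div_add_atTop (1:ℝ))
  have h3 := h1.add h2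
  simp only [zero_mul, zero_add] at h3
  refine h3.congr' ?_
  filter_upwards [eventually_ge_atTop 1] with N hN
  have : (0:ℝ) < N := by exact_mod_cast hN
  rw [digSum_succ]
  push_cast
  field_simp

theorem measurable_greedyT : Measurable greedyT := by
  unfold greedyT
  exact Measurable.ite measurableSet_Iio (by fun_prop) (by fun_prop)

theorem measurable_greedyDigit (k : ℕ) : Measurable (fun x => greedyDigit x k) := by
  unfold greedyDigit
  exact Measurable.ite (measurableSet_Ici.preimage (measurable_greedyT.iterate k))
    measurable_const measurable_const

theorem measurableSet_hasFreq (γ : ℝ) : MeasurableSet {x | HasFreq γ x} := by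
  unfold HasFreq
  apply measurableSet_tendsto
  intro N
  exact (Finset.measurable_sum _ fun k _ => measurable_greedyDigit k).div_const _

/-- From `[0,1)` to everything. -/
theorem extend_ae (ρ : Measure ℝ) (γ : ℝ) (q : ENNReal) (hq : q < 1)
    (hfin : ρ (Set.Ico 0 goldenMean) ≠ ⊤)
    (h : ∀ᵐ x ∂ρ, x ∈ Set.Ico (0:ℝ) 1 → HasFreq γ x)
    (hsc : ∀ A, MeasurableSet A → A ⊆ Set.Ico 1 goldenMean →
      ρ A ≤ q * ρ {z | z ∈ Set.Ico 0 goldenMean ∧ (z + 1) / goldenMean ∈ A}) :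
    ∀ᵐ x ∂ρ, x ∈ Set.Ico (0:ℝ) goldenMean → HasFreq γ x := by
  set E : Set ℝ := Set.Ico 1 goldenMean ∩ {x | HasFreq γ x}ᶜ with hE
  have hEm : MeasurableSet E := measurableSet_Ico.inter (measurableSet_hasFreq γ).compl
  have h1 := hsc E hEm Set.inter_subset_left
  have h2 : ρ {z | z ∈ Set.Ico 0 goldenMean ∧ (z + 1) / goldenMean ∈ E} ≤ ρ E := by
    apply measure_mono_ae
    filter_upwards [h] with z hz hz2
    obtain ⟨⟨hz0, hzb⟩, hz3, hz4⟩ := hz2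
    have hT : greedyT ((z + 1) / goldenMean) = z := by
      rw [(digit_zero_of_ge _).2]
      · field_simp [gm_pos.ne']; ring
      · have := gm_pos
        gcongr; linarith
    have hbad : ¬ HasFreq γ z := fun hf => hz4 (hasFreq_of_T (by rwa [hT]))
    refine ⟨⟨?_, hzb⟩, hbad⟩
    by_contra hlt
    exact hbad (hz ⟨hz0, not_le.1 hlt⟩)
  have h3 : ρ E = 0 := by
    by_contra hne
    have hEf : ρ E ≠ ⊤ := ne_top_of_le_ne_top hfin (measure_mono fun x hx =>
      ⟨by linarith [hx.1.1], hx.1.2⟩)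
    have : ρ E ≤ q * ρ E := h1.trans (by gcongr)
    have h4 : q * ρ E < 1 * ρ E := ENNReal.mul_lt_mul_left hne hEf hq
    rw [one_mul] at h4
    exact absurd this (not_le.2 h4)
  have h4 : ∀ᵐ x ∂ρ, x ∉ E := by
    rw [ae_iff]; simpa using h3
  filter_upwards [h, h4] with x hx1 hx2 hx3
  by_cases hlt : x < 1
  · exact hx1 ⟨hx3.1, hlt⟩
  · by_contra hbad
    exact hx2 ⟨⟨not_lt.1 hlt, hx3.2⟩, hbad⟩

/-- Set-level description of the two branches. -/
theorem branch0 (F : Set ℝ) : blockS ⁻¹' F ∩ (Set.Ici (1 / goldenMean))ᶜ ∩ Set.Ico 0 1 =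
    {x | goldenMean * x ∈ F ∩ Set.Ico 0 1} := by
  have hp := gm_pos
  have h2 := gm_gt
  have h1 := gm_sq
  ext x
  simp only [Set.mem_inter_iff, Set.mem_preimage, Set.mem_compl_iff, Set.mem_Ici, not_le,
    Set.mem_Ico, Set.mem_ofPred_eq]
  constructor
  · rintro ⟨⟨hF, hlt⟩, hx0, hx1⟩
    have := blockS_mem ⟨hx0, hx1⟩
    rw [blockS, if_pos hlt] at hF this
    exact ⟨hF, this⟩
  · rintro ⟨hF, hx0, hx1⟩
    have hlt : x < 1 / goldenMean := by rw [lt_div_iff₀ hp]; linarith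
    refine ⟨⟨?_, hlt⟩, ?_, ?_⟩
    · rw [blockS, if_pos hlt]; exact hF
    · nlinarith
    · rw [gm_inv] at hlt; nlinarith

theorem branch1 (F : Set ℝ) : blockS ⁻¹' F ∩ (Set.Ici (1 / goldenMean)) ∩ Set.Ico 0 1 =
    {x | goldenMean ^ 2 * x - goldenMean ∈ F ∩ Set.Ico 0 1} := by
  have hp := gm_pos
  have h2 := gm_gt
  have h1 := gm_sq
  ext x
  simp only [Set.mem_inter_iff, Set.mem_preimage, Set.mem_Ici,
    Set.mem_Ico, Set.mem_ofPred_eq]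
  constructor
  · rintro ⟨⟨hF, hlt⟩, hx0, hx1⟩
    have := blockS_mem ⟨hx0, hx1⟩
    rw [blockS, if_neg (not_lt.2 hlt)] at hF this
    exact ⟨hF, this⟩
  · rintro ⟨hF, hx0, hx1⟩
    have hlt : 1 / goldenMean ≤ x := by rw [div_le_iff₀ hp]; nlinarith
    refine ⟨⟨?_, hlt⟩, ?_, ?_⟩
    · rw [blockS, if_neg (not_lt.2 hlt)]; exact hF
    · rw [gm_inv] at hlt; nlinarith
    · rw [h1] at hx1; nlinarith

theorem branch0_apply (κ : Measure ℝ) {F : Set ℝ} (hF : MeasurableSet F) :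
    (((κ.restrict (Set.Ico 0 1)).restrict (Set.Ici (1 / goldenMean))ᶜ).map blockS) F =
      κ {x | goldenMean * x ∈ F ∩ Set.Ico 0 1} := by
  rw [Measure.map_apply measurable_blockS hF, Measure.restrict_apply (measurable_blockS hF),
    Measure.restrict_apply ((measurable_blockS hF).inter measurableSet_Ici.compl), branch0]

theorem branch1_apply (κ : Measure ℝ) {F : Set ℝ} (hF : MeasurableSet F) :
    (((κ.restrict (Set.Ico 0 1)).restrict (Set.Ici (1 / goldenMean))).map blockS) F =
      κ {x | goldenMean ^ 2 * x - goldenMean ∈ F ∩ Set.Ico 0 1} := by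
  rw [Measure.map_apply measurable_blockS hF, Measure.restrict_apply (measurable_blockS hF),
    Measure.restrict_apply ((measurable_blockS hF).inter measurableSet_Ici), branch1]

theorem lln_core {V : Type*} (μ : V → Measure ℝ) [∀ v, IsFiniteMeasure (μ v)] (γ : ℝ)
    (hγ0 : 0 ≤ γ) (hγ1 : γ ≤ 1) (M0 M1 : V → V)
    (h0 : ∀ v, ((μ v).restrict (Set.Ici (1 / goldenMean))ᶜ).map blockS = μ (M0 v))
    (h1 : ∀ v, ((μ v).restrict (Set.Ici (1 / goldenMean))).map blockS = μ (M1 v))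
    (g : V → ℝ) (K : ℝ) (hg : ∀ v, |g v| ≤ K * (μ v).real Set.univ)
    (hP : ∀ v, g (M0 v) + g (M1 v) + (-γ) * (μ (M0 v)).real Set.univ
      + (1 - 2 * γ) * (μ (M1 v)).real Set.univ = g v) (v : V) :
    ∀ᵐ x ∂μ v, x ∈ Set.Ico (0:ℝ) 1 → HasFreq γ x := by
  have b0 : |-γ| ≤ 1 := by rw [abs_le]; constructor <;> linarith
  have b1 : |1 - 2 * γ| ≤ 1 := by rw [abs_le]; constructor <;> linarith
  have := block_lln μ blockS measurable_blockS (Set.Ici (1 / goldenMean)) measurableSet_Ici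
    (blockC γ) (measurable_blockC γ) (fun x => by unfold blockC; split_ifs <;> assumption)
    (-γ) (1 - 2 * γ) (fun x hx => if_pos (not_le.1 (fun hle => hx hle))) (fun x hx => if_neg (not_lt.2 hx))
    b0 b1 M0 M1 h0 h1 g K hg hP v
  filter_upwards [this] with x hx hx2
  exact hasFreq_of_block hγ0 hγ1 hx2 hx

open scoped NNReal in
theorem lebesgue_freq : ∀ᵐ x ∂(volume : Measure ℝ), x ∈ Set.Ico (0:ℝ) goldenMean →
    HasFreq (1 / (goldenMean ^ 2 + 1)) x := by
  have hp := gm_pos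
  have hsq := gm_sq
  have hgt := gm_gt
  set b : ℝ≥0 := ⟨goldenMean, hp.le⟩ with hb
  have hbinv : ((b⁻¹ : ℝ≥0) : ENNReal) = ENNReal.ofReal |goldenMean⁻¹| := by
    rw [abs_of_nonneg (by positivity), ENNReal.ofReal, ENNReal.coe_inj]
    ext
    rw [Real.coe_toNNReal _ (by positivity)]
    push_cast
    try simp only [inv_pow]
    rfl
  have hbinv2 : (((b⁻¹)^2 : ℝ≥0) : ENNReal) = ENNReal.ofReal |(goldenMean^2)⁻¹| := by
    rw [abs_of_nonneg (by positivity), ENNReal.ofReal, ENNReal.coe_inj]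
    ext
    rw [Real.coe_toNNReal _ (by positivity)]
    push_cast
    try simp only [inv_pow]
    rfl
  set L : Measure ℝ := volume.restrict (Set.Ico 0 1) with hL
  have hLu : L.real Set.univ = 1 := by
    simp [hL, Measure.real]
  have vol0 : ∀ F : Set ℝ, MeasurableSet F →
      volume {x | goldenMean * x ∈ F ∩ Set.Ico 0 1} = ((b⁻¹ : ℝ≥0) : ENNReal) * L F := by
    intro F hF
    rw [hL, Measure.restrict_apply hF, hbinv]
    exact Real.volume_preimage_mul_left hp.ne' _
  have vol1 : ∀ F : Set ℝ, MeasurableSet F →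
      volume {x | goldenMean ^ 2 * x - goldenMean ∈ F ∩ Set.Ico 0 1} =
        (((b⁻¹) ^ 2 : ℝ≥0) : ENNReal) * L F := by
    intro F hF
    rw [hL, Measure.restrict_apply hF, hbinv2]
    have := Real.volume_preimage_mul_left (a := goldenMean ^ 2) (by positivity)
      ((fun y => y - goldenMean) ⁻¹' (F ∩ Set.Ico 0 1))
    have e : volume ((fun y => y - goldenMean) ⁻¹' (F ∩ Set.Ico 0 1)) =
        volume (F ∩ Set.Ico 0 1) := by
      simp_rw [sub_eq_add_neg]
      exact measure_preimage_add_right _ _ _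
    rw [e] at this
    exact this
  have hγ0 : 0 ≤ 1 / (goldenMean ^ 2 + 1) := by positivity
  have real_smul : ∀ s : ℝ≥0, (s • L).real Set.univ = s := by
    intro s
    rw [measureReal_nnreal_smul_apply, hLu, mul_one]
  have core := lln_core (V := ℝ≥0) (fun s => s • L) (1 / (goldenMean ^ 2 + 1)) hγ0 gm_inv2
    (fun s => s * b⁻¹) (fun s => s * (b⁻¹) ^ 2)
    (fun s => by
      ext F hF
      rw [Measure.restrict_smul, Measure.map_smul, Measure.smul_apply, Measure.smul_apply,
        branch0_apply _ hF, vol0 F hF, ENNReal.smul_def, ENNReal.smul_def, smul_eq_mul,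
        smul_eq_mul, ENNReal.coe_mul, mul_assoc])
    (fun s => by
      ext F hF
      rw [Measure.restrict_smul, Measure.map_smul, Measure.smul_apply, Measure.smul_apply,
        branch1_apply _ hF, vol1 F hF, ENNReal.smul_def, ENNReal.smul_def, smul_eq_mul,
        smul_eq_mul, ENNReal.coe_mul, mul_assoc])
    (fun _ => 0) 0 (fun s => by simp)
    (fun s => by
      rw [real_smul, real_smul]
      have : (b : ℝ) = goldenMean := rfl
      push_cast
      rw [this]
      field_simp
      nlinarith) 1
  rw [one_smul, hL] at core
  have h1 : ∀ᵐ x ∂(volume : Measure ℝ), x ∈ Set.Ico (0:ℝ) 1 →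
      HasFreq (1 / (goldenMean ^ 2 + 1)) x := by
    have := (ae_restrict_iff' measurableSet_Ico).1 core
    filter_upwards [this] with x hx h
    exact hx h h
  refine extend_ae volume _ ((b⁻¹ : ℝ≥0) : ENNReal) ?_ ?_ h1 ?_
  · have : b⁻¹ < 1 := inv_lt_one_of_one_lt₀ (by exact_mod_cast hgt)
    exact_mod_cast this
  · simp
  · intro A hA hA2
    have h2 : A = (fun x => goldenMean * x) ⁻¹' ((fun y => y + (-1)) ⁻¹'
        {z | z ∈ Set.Ico 0 goldenMean ∧ (z + 1) / goldenMean ∈ A}) := by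
      ext x
      simp only [Set.mem_preimage, Set.mem_ofPred_eq]
      have e : (goldenMean * x + -1 + 1) / goldenMean = x := by field_simp; ring
      rw [e]
      refine ⟨fun hx => ⟨?_, hx⟩, fun hx => hx.2⟩
      have := hA2 hx
      constructor <;> nlinarith [this.1, this.2]
    conv_lhs => rw [h2]
    rw [Real.volume_preimage_mul_left hp.ne', measure_preimage_add_right, hbinv]

section nu

/-- The facts about the Bernoulli convolution which are used. -/
structure GoodNu (ν : Measure ℝ) (h : NNReal) : Prop where
  half : 2 * h = 1
  prob : IsProbabilityMeasure ν
  self : ∀ A : Set ℝ, MeasurableSet A → ν A = h * ν {z | z / goldenMean ∈ A} +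
    h * ν {z | (z + 1) / goldenMean ∈ A}
  neg : ν (Set.Iio 0) = 0
  big : ν (Set.Ici goldenMean) = 0

variable {ν : Measure ℝ} {h : NNReal}

/-- Translated restricted measure. -/
noncomputable def nuSh (ν : Measure ℝ) (d : ℝ) : Measure ℝ :=
  (ν.map (fun y => y - d)).restrict (Set.Ico 0 1)

theorem nuSh_apply (ν : Measure ℝ) (d : ℝ) {F : Set ℝ} (hF : MeasurableSet F) :
    nuSh ν d F = ν {y | y - d ∈ F ∩ Set.Ico 0 1} := by
  rw [nuSh, Measure.restrict_apply hF, Measure.map_apply (by fun_prop) (hF.inter measurableSet_Ico)]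
  rfl

theorem nuSh_neg (H : GoodNu ν h) {d : ℝ} (hd : d ≤ -1) : nuSh ν d = 0 := by
  ext F hF
  rw [nuSh_apply _ _ hF]
  refine measure_mono_null ?_ H.neg
  intro y hy
  have := hy.2.2
  simp only [Set.mem_Iio]
  linarith

theorem nuSh_big (H : GoodNu ν h) {d : ℝ} (hd : goldenMean ≤ d) : nuSh ν d = 0 := by
  ext F hF
  rw [nuSh_apply _ _ hF]
  refine measure_mono_null ?_ H.big
  intro y hy
  have := hy.2.1
  simp only [Set.mem_Ici]
  linarith

theorem nu_Z (H : GoodNu ν h) (d : ℝ) {F : Set ℝ} (hF : MeasurableSet F) :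
    ν {y | goldenMean * (y - d) ∈ F ∩ Set.Ico 0 1} =
      h * nuSh ν (goldenMean * d) F + h * nuSh ν (goldenMean * d - 1) F := by
  have hp := gm_pos
  rw [H.self {y | goldenMean * (y - d) ∈ F ∩ Set.Ico 0 1} ((hF.inter measurableSet_Ico).preimage
    (by fun_prop : Measurable fun y : ℝ => goldenMean * (y - d))), nuSh_apply _ _ hF,
    nuSh_apply _ _ hF]
  have e1 : ∀ z : ℝ, goldenMean * (z / goldenMean - d) = z - goldenMean * d := by
    intro z; field_simp
  have e2 : ∀ z : ℝ, z + 1 - goldenMean * d = z - (goldenMean * d - 1) := by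
    intro z; ring
  simp only [Set.mem_preimage, Set.mem_ofPred_eq, e1, e2]

theorem nu_O (H : GoodNu ν h) (d : ℝ) {F : Set ℝ} (hF : MeasurableSet F) :
    ν {y | goldenMean ^ 2 * (y - d) - goldenMean ∈ F ∩ Set.Ico 0 1} =
      h * (h * nuSh ν (goldenMean * (goldenMean * d + 1)) F +
        h * nuSh ν (goldenMean * (goldenMean * d + 1) - 1) F) +
      h * (h * nuSh ν (goldenMean * (goldenMean * d)) F +
        h * nuSh ν (goldenMean * (goldenMean * d) - 1) F) := by
  have hp := gm_pos
  rw [H.self {y | goldenMean ^ 2 * (y - d) - goldenMean ∈ F ∩ Set.Ico 0 1}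
    ((hF.inter measurableSet_Ico).preimage
    (by fun_prop : Measurable fun y : ℝ => goldenMean ^ 2 * (y - d) - goldenMean)),
    ← nu_Z H _ hF, ← nu_Z H _ hF]
  have e1 : ∀ z : ℝ, goldenMean ^ 2 * (z / goldenMean - d) - goldenMean
      = goldenMean * (z - (goldenMean * d + 1)) := by
    intro z; field_simp; ring
  have e2 : ∀ z : ℝ, goldenMean * (z + 1 - (goldenMean * d + 1))
      = goldenMean * (z - goldenMean * d) := by
    intro z; ring
  simp only [Set.mem_preimage, Set.mem_ofPred_eq, e1, e2]

theorem nuSh_branch0 (H : GoodNu ν h) (d : ℝ) :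
    ((nuSh ν d).restrict (Set.Ici (1 / goldenMean))ᶜ).map blockS =
      h • nuSh ν (goldenMean * d) + h • nuSh ν (goldenMean * d - 1) := by
  ext F hF
  rw [nuSh, branch0_apply _ hF, Measure.map_apply (s := {x | goldenMean * x ∈ F ∩ Set.Ico 0 1}) (by fun_prop)
    ((hF.inter measurableSet_Ico).preimage (by fun_prop : Measurable fun y : ℝ => goldenMean * y))]
  exact nu_Z H d hF

theorem nuSh_branch1 (H : GoodNu ν h) (d : ℝ) :
    ((nuSh ν d).restrict (Set.Ici (1 / goldenMean))).map blockS =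
      h • (h • nuSh ν (goldenMean * (goldenMean * d + 1)) +
        h • nuSh ν (goldenMean * (goldenMean * d + 1) - 1)) +
      h • (h • nuSh ν (goldenMean * (goldenMean * d)) +
        h • nuSh ν (goldenMean * (goldenMean * d) - 1)) := by
  ext F hF
  rw [nuSh, branch1_apply _ hF, Measure.map_apply
    (s := {x | goldenMean ^ 2 * x - goldenMean ∈ F ∩ Set.Ico 0 1}) (by fun_prop)
    ((hF.inter measurableSet_Ico).preimage
      (by fun_prop : Measurable fun y : ℝ => goldenMean ^ 2 * y - goldenMean))]
  exact nu_O H d hF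

/-- The family of measures. -/
noncomputable def muV (ν : Measure ℝ) (v : NNReal × NNReal × NNReal) : Measure ℝ :=
  v.1 • nuSh ν 0 + v.2.1 • nuSh ν (1 / goldenMean) + v.2.2 • nuSh ν 1

theorem muV_branch0 (H : GoodNu ν h) (v : NNReal × NNReal × NNReal) :
    ((muV ν v).restrict (Set.Ici (1 / goldenMean))ᶜ).map blockS =
      muV ν (h * (v.1 + v.2.1), h * v.2.2, h * v.2.1) := by
  have hp := gm_pos
  have e1 : goldenMean * (1 / goldenMean) = 1 := by field_simp
  have e2 : goldenMean * 1 - 1 = 1 / goldenMean := by rw [gm_inv]; ring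
  have hm := measurable_blockS
  simp only [muV, Measure.restrict_add, Measure.restrict_smul, Measure.map_add _ _ hm,
    Measure.map_smul, nuSh_branch0 H, e1, e2]
  rw [mul_zero, nuSh_neg H (d := 0 - 1) (by norm_num), nuSh_big H (d := goldenMean * 1) (by simp),
    sub_self]
  simp only [smul_zero, add_zero, zero_add]
  module

theorem muV_branch1 (H : GoodNu ν h) (v : NNReal × NNReal × NNReal) :
    ((muV ν v).restrict (Set.Ici (1 / goldenMean))).map blockS =
      muV ν (h * h * v.1, h * h * (v.1 + v.2.1), 0) := by
  have hp := gm_pos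
  have hsq := gm_sq
  have hgt := gm_gt
  have e1 : goldenMean * (1 / goldenMean) = 1 := by field_simp
  have e2 : goldenMean - 1 = 1 / goldenMean := by rw [gm_inv]
  have hm := measurable_blockS
  simp only [muV, Measure.restrict_add, Measure.restrict_smul, Measure.map_add _ _ hm,
    Measure.map_smul, nuSh_branch1 H, e1, mul_zero, zero_add, mul_one, e2]
  rw [nuSh_neg H (d := 0 - 1) (by norm_num), nuSh_big H (d := goldenMean) le_rfl,
    nuSh_big H (d := goldenMean * (1 + 1)) (by linarith),
    nuSh_big H (d := goldenMean * (1 + 1) - 1) (by linarith),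
    nuSh_big H (d := goldenMean * (goldenMean + 1)) (by nlinarith),
    nuSh_big H (d := goldenMean * (goldenMean + 1) - 1) (by nlinarith),
    nuSh_big H (d := goldenMean * goldenMean) (by nlinarith),
    nuSh_big H (d := goldenMean * goldenMean - 1) (by nlinarith)]
  simp only [smul_zero, add_zero, zero_add, zero_smul]
  module

theorem nu_freq (H : GoodNu ν h) : ∀ᵐ x ∂ν, x ∈ Set.Ico (0:ℝ) goldenMean →
    HasFreq (5 / 18) x := by
  have hp := gm_pos
  have hsq := gm_sq
  have hgt := gm_gt
  have := H.prob
  have fsh : ∀ d, IsFiniteMeasure (nuSh ν d) := fun d => by unfold nuSh; infer_instance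
  have fm : ∀ v, IsFiniteMeasure (muV ν v) := fun v => by unfold muV; infer_instance
  set p := (nuSh ν 0).real Set.univ with hpdef
  set q := (nuSh ν (1 / goldenMean)).real Set.univ with hq
  set r := (nuSh ν 1).real Set.univ with hr
  have hh : (h : ℝ) = 1 / 2 := by
    have := congrArg (fun t : NNReal => (t : ℝ)) H.half
    push_cast at this; linarith
  have tot : ∀ v, (muV ν v).real Set.univ = v.1 * p + v.2.1 * q + v.2.2 * r := by
    intro v
    rw [muV, measureReal_add_apply, measureReal_add_apply, measureReal_nnreal_smul_apply,
      measureReal_nnreal_smul_apply, measureReal_nnreal_smul_apply]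
  have mass : ∀ v, (muV ν v).real Set.univ =
      (muV ν (h * (v.1 + v.2.1), h * v.2.2, h * v.2.1)).real Set.univ +
      (muV ν (h * h * v.1, h * h * (v.1 + v.2.1), 0)).real Set.univ := by
    intro v
    rw [← muV_branch0 H, ← muV_branch1 H, map_measureReal_apply measurable_blockS MeasurableSet.univ,
      map_measureReal_apply measurable_blockS MeasurableSet.univ]
    simp only [Set.preimage_univ, measureReal_restrict_apply MeasurableSet.univ, Set.univ_inter]
    rw [add_comm, measureReal_add_measureReal_compl measurableSet_Ici]
  have m1 := mass (1, 0, 0)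
  have m2 := mass (0, 1, 0)
  simp only [tot] at m1 m2
  push_cast at m1 m2
  rw [hh] at m1 m2
  have hqp : q = p := by linarith
  have hrp : r = p / 2 := by linarith
  have p0 : 0 ≤ p := measureReal_nonneg
  have core := lln_core (muV ν) (5 / 18) (by norm_num) (by norm_num)
    (fun v => (h * (v.1 + v.2.1), h * v.2.2, h * v.2.1))
    (fun v => (h * h * v.1, h * h * (v.1 + v.2.1), 0))
    (muV_branch0 H) (muV_branch1 H)
    (fun v => p * ((v.1 : ℝ) / 6 - v.2.1 / 6 - 2 * v.2.2 / 9)) 1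
    (fun v => by
      rw [tot, hqp, hrp]
      have a1 : 0 ≤ p * v.1 := mul_nonneg p0 v.1.2
      have a2 : 0 ≤ p * v.2.1 := mul_nonneg p0 v.2.1.2
      have a3 : 0 ≤ p * v.2.2 := mul_nonneg p0 v.2.2.2
      rw [abs_le]
      constructor <;> nlinarith)
    (fun v => by
      rw [tot, tot, hqp, hrp]
      push_cast
      rw [hh]
      ring) (1, 0, 0)
  have e : muV ν (1, 0, 0) = ν.restrict (Set.Ico 0 1) := by
    simp [muV, nuSh]
  rw [e] at core
  have h1 : ∀ᵐ x ∂ν, x ∈ Set.Ico (0:ℝ) 1 → HasFreq (5 / 18) x := by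
    have := (ae_restrict_iff' measurableSet_Ico).1 core
    filter_upwards [this] with x hx h
    exact hx h h
  refine extend_ae ν _ (h : ENNReal) ?_ (measure_ne_top _ _) h1 ?_
  · have : h < 1 := by
      rw [← NNReal.coe_lt_coe, hh]; norm_num
    exact_mod_cast this
  · intro A hA hA2
    rw [H.self A hA]
    have z1 : ν {z | z / goldenMean ∈ A} = 0 := by
      refine measure_mono_null (fun z hz => ?_) H.big
      have := (hA2 hz).1
      rw [le_div_iff₀ hp] at this
      simpa using this
    rw [z1, mul_zero, zero_add]
    refine mul_le_mul_right (measure_mono_ae ?_) _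
    have : ∀ᵐ x ∂ν, x ∉ Set.Ici goldenMean := measure_eq_zero_iff_ae_notMem.1 H.big
    filter_upwards [this] with z hz hz2
    refine ⟨⟨?_, not_le.1 hz⟩, hz2⟩
    have := (hA2 hz2).1
    rw [le_div_iff₀ hp] at this
    linarith

end nu

section bern

/-- Prepend a digit. -/
def consB (b : Fin 2) (a : ℕ → Fin 2) : ℕ → Fin 2
  | 0 => b
  | n + 1 => a n

theorem measurable_consB (b : Fin 2) : Measurable (consB b) := by
  rw [measurable_pi_iff]
  rintro (_ | n)
  · exact measurable_const
  · exact measurable_pi_apply n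

theorem measurableSet_cyl (s : Finset ℕ) (f : ℕ → Fin 2) :
    MeasurableSet {a : ℕ → Fin 2 | ∀ i ∈ s, a i = f i} := by
  have : {a : ℕ → Fin 2 | ∀ i ∈ s, a i = f i} =
      ⋂ i ∈ s, (fun a : ℕ → Fin 2 => a i) ⁻¹' {f i} := by
    ext a; simp
  rw [this]
  exact Finset.measurableSet_biInter _ fun i _ => measurable_pi_apply i (measurableSet_singleton _)

theorem bern_unique (m m' : Measure (ℕ → Fin 2)) (hm : IsBernoulliHalf m)
    (hm' : IsBernoulliHalf m') : m = m' := by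
  have := hm.1
  have := hm'.1
  refine ext_of_generate_finite
    {A | A = ∅ ∨ ∃ (s : Finset ℕ) (f : ℕ → Fin 2), A = {a | ∀ i ∈ s, a i = f i}} ?_ ?_ ?_ ?_
  · apply le_antisymm
    · refine iSup_le fun i => ?_
      rw [← measurable_iff_comap_le]
      refine @measurable_to_countable' _ _ _ _ (_) _ fun j => ?_
      apply MeasurableSpace.measurableSet_generateFrom
      right
      refine ⟨{i}, fun _ => j, ?_⟩
      ext a; simp
    · apply MeasurableSpace.generateFrom_le
      rintro A (rfl | ⟨s, f, rfl⟩)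
      · exact MeasurableSet.empty
      · exact measurableSet_cyl s f
  · rintro A (rfl | ⟨s, f, rfl⟩) B (rfl | ⟨t, g, rfl⟩) ⟨a0, ha, hb⟩
    · exact absurd ha (Set.notMem_empty _)
    · exact absurd ha (Set.notMem_empty _)
    · exact absurd hb (Set.notMem_empty _)
    · right
      refine ⟨s ∪ t, a0, ?_⟩
      ext a
      simp only [Set.mem_inter_iff, Set.mem_ofPred_eq, Finset.mem_union] at *
      constructor
      · rintro ⟨h1, h2⟩ i (hi | hi)
        · rw [h1 i hi, ha i hi]
        · rw [h2 i hi, hb i hi]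
      · intro h1
        exact ⟨fun i hi => by rw [h1 i (Or.inl hi), ha i hi],
          fun i hi => by rw [h1 i (Or.inr hi), hb i hi]⟩
  · rintro A (rfl | ⟨s, f, rfl⟩)
    · simp
    · rw [hm.2, hm'.2]
  · simp

theorem bern_self (m : Measure (ℕ → Fin 2)) (hm : IsBernoulliHalf m) :
    m = (1 / 2 : ENNReal) • m.map (consB 0) + (1 / 2 : ENNReal) • m.map (consB 1) := by
  have := hm.1
  have hhalf : (1 / 2 : ENNReal) + 1 / 2 = 1 := ENNReal.add_halves 1
  apply bern_unique m _ hm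
  refine ⟨⟨?_⟩, ?_⟩
  · rw [Measure.add_apply, Measure.smul_apply, Measure.smul_apply,
      Measure.map_apply (measurable_consB _) MeasurableSet.univ,
      Measure.map_apply (measurable_consB _) MeasurableSet.univ]
    simp only [Set.preimage_univ, measure_univ, smul_eq_mul, mul_one]
    exact hhalf
  · intro s f
    rw [Measure.add_apply, Measure.smul_apply, Measure.smul_apply,
      Measure.map_apply (measurable_consB _) (measurableSet_cyl s f),
      Measure.map_apply (measurable_consB _) (measurableSet_cyl s f)]
    simp only [smul_eq_mul]
    set t : Finset ℕ := s.preimage Nat.succ (Nat.succ_injective.injOn) with ht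
    have hcyl := hm.2 t (fun i => f (i + 1))
    set Q : Set (ℕ → Fin 2) := {a | ∀ i ∈ t, a i = f (i + 1)} with hQ
    have hpre : ∀ b, (0 ∈ s → b = f 0) → consB b ⁻¹' {a | ∀ i ∈ s, a i = f i} = Q := by
      intro b hb
      ext a
      simp only [Set.mem_preimage, Set.mem_ofPred_eq, hQ, ht, Finset.mem_preimage]
      constructor
      · intro h i hi
        exact h (i + 1) hi
      · rintro h (_ | i) hi
        · exact hb hi
        · exact h i hi
    by_cases h0 : 0 ∈ s
    · have hs : s = insert 0 (t.map ⟨Nat.succ, Nat.succ_injective⟩) := by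
        ext i
        rcases i with _ | i
        · simp [h0]
        · simp [ht]
      have hcard : s.card = t.card + 1 := by
        conv_lhs => rw [hs]
        rw [Finset.card_insert_of_notMem (by simp), Finset.card_map]
      have hempty : ∀ b, b ≠ f 0 → consB b ⁻¹' {a | ∀ i ∈ s, a i = f i} = ∅ := by
        intro b hb
        ext a
        simp only [Set.mem_preimage, Set.mem_ofPred_eq, Set.mem_empty_iff_false, iff_false]
        intro h
        exact hb (h 0 h0)
      rw [hcard, pow_succ, mul_comm]
      have hf : f 0 = 0 ∨ f 0 = 1 := by
        generalize f 0 = z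
        revert z; decide
      rcases hf with hf | hf
      · rw [hpre 0 (fun _ => hf.symm), hempty 1 (by rw [hf]; decide), hcyl]
        simp [mul_comm]
      · rw [hpre 1 (fun _ => hf.symm), hempty 0 (by rw [hf]; decide), hcyl]
        simp [mul_comm]
    · have hs : s = t.map ⟨Nat.succ, Nat.succ_injective⟩ := by
        ext i
        rcases i with _ | i
        · simp [h0]
        · simp [ht]
      have hcard : s.card = t.card := by
        conv_lhs => rw [hs]
        rw [Finset.card_map]
      rw [hpre 0 (fun h => absurd h h0), hpre 1 (fun h => absurd h h0), hcyl, hcard, ← add_mul,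
        hhalf, one_mul]

theorem zpow_eq (n : ℕ) : goldenMean ^ (-((n : ℤ) + 1)) = (goldenMean⁻¹) ^ (n + 1) := by
  rw [zpow_neg, inv_pow]
  norm_cast

theorem hasSum_geo : HasSum (fun n : ℕ => goldenMean ^ (-((n : ℤ) + 1))) goldenMean := by
  have hgt := gm_gt
  have hp := gm_pos
  simp_rw [zpow_eq]
  have h := (hasSum_geometric_of_lt_one (r := goldenMean⁻¹) (by positivity)
    (inv_lt_one_of_one_lt₀ hgt)).mul_right (goldenMean⁻¹)
  simp_rw [← pow_succ] at h
  suffices e : (1 - goldenMean⁻¹)⁻¹ * goldenMean⁻¹ = goldenMean by rwa [e] at h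
  have hi : goldenMean⁻¹ = goldenMean - 1 := by rw [← one_div, gm_inv]
  rw [hi]
  have hsq := gm_sq
  have : (1 - (goldenMean - 1)) ≠ 0 := by linarith [gm_lt]
  field_simp
  nlinarith

theorem term_nonneg (a : ℕ → Fin 2) (n : ℕ) :
    0 ≤ (a n : ℝ) * goldenMean ^ (-((n : ℤ) + 1)) := by
  have hp := gm_pos
  positivity

theorem term_le (a : ℕ → Fin 2) (n : ℕ) :
    (a n : ℝ) * goldenMean ^ (-((n : ℤ) + 1)) ≤ goldenMean ^ (-((n : ℤ) + 1)) := by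
  have hp := gm_pos
  have h1 : ((a n : ℕ) : ℝ) ≤ 1 := by
    have : (a n : ℕ) ≤ 1 := by omega
    exact_mod_cast this
  have h2 : 0 < goldenMean ^ (-((n : ℤ) + 1)) := by positivity
  nlinarith

theorem term_summable (a : ℕ → Fin 2) :
    Summable fun n : ℕ => (a n : ℝ) * goldenMean ^ (-((n : ℤ) + 1)) :=
  Summable.of_nonneg_of_le (term_nonneg a) (term_le a) hasSum_geo.summable

theorem projPi_nonneg (a : ℕ → Fin 2) : 0 ≤ projPi a := tsum_nonneg (term_nonneg a)

theorem projPi_le (a : ℕ → Fin 2) : projPi a ≤ goldenMean := by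
  rw [← hasSum_geo.tsum_eq]
  exact (term_summable a).tsum_le_tsum (term_le a) hasSum_geo.summable

theorem measurable_projPi : Measurable projPi := by
  apply Continuous.measurable
  unfold projPi
  refine continuous_tsum (u := fun n : ℕ => goldenMean ^ (-((n : ℤ) + 1))) ?_
    hasSum_geo.summable ?_
  · intro n
    refine Continuous.mul ?_ continuous_const
    exact (continuous_of_discreteTopology (f := fun z : Fin 2 => ((z : ℕ) : ℝ))).comp
      (continuous_apply n)
  · intro n a
    rw [Real.norm_of_nonneg (term_nonneg a n)]
    exact term_le a n

theorem projPi_consB (b : Fin 2) (a : ℕ → Fin 2) :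
    projPi (consB b a) = (projPi a + (b : ℝ)) / goldenMean := by
  have hp := gm_pos
  unfold projPi
  rw [(term_summable (consB b a)).tsum_eq_zero_add]
  have : ∀ n : ℕ, ((consB b a (n + 1) : Fin 2) : ℝ) * goldenMean ^ (-(((n + 1 : ℕ) : ℤ) + 1)) =
      ((a n : ℝ) * goldenMean ^ (-((n : ℤ) + 1))) * goldenMean⁻¹ := by
    intro n
    rw [zpow_eq, zpow_eq, pow_succ _ (n + 1), mul_assoc]
    rfl
  simp_rw [this]
  rw [tsum_mul_right]
  have e : ((consB b a 0 : Fin 2) : ℝ) * goldenMean ^ (-(((0 : ℕ) : ℤ) + 1)) =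
      (b : ℝ) * goldenMean⁻¹ := by
    rw [zpow_eq]
    simp [consB]
  rw [e]
  ring

theorem goodNu (m : Measure (ℕ → Fin 2)) (hm : IsBernoulliHalf m) :
    GoodNu (m.map projPi) (1 / 2) := by
  have := hm.1
  have hp := gm_pos
  have hgt := gm_gt
  have hpi := measurable_projPi
  have hcoe : (((1 / 2 : NNReal)) : ENNReal) = 1 / 2 := by simp
  have hprob : IsProbabilityMeasure (m.map projPi) := Measure.isProbabilityMeasure_map hpi.aemeasurable
  have self : ∀ A : Set ℝ, MeasurableSet A → m.map projPi A =
      ((1 / 2 : NNReal) : ENNReal) * m.map projPi {z | z / goldenMean ∈ A} +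
      ((1 / 2 : NNReal) : ENNReal) * m.map projPi {z | (z + 1) / goldenMean ∈ A} := by
    intro A hA
    have hA0 : MeasurableSet {z : ℝ | z / goldenMean ∈ A} :=
      hA.preimage (by fun_prop : Measurable fun z : ℝ => z / goldenMean)
    have hA1 : MeasurableSet {z : ℝ | (z + 1) / goldenMean ∈ A} :=
      hA.preimage (by fun_prop : Measurable fun z : ℝ => (z + 1) / goldenMean)
    rw [Measure.map_apply hpi hA, Measure.map_apply hpi hA0, Measure.map_apply hpi hA1, hcoe]
    conv_lhs => rw [bern_self m hm]
    rw [Measure.add_apply, Measure.smul_apply, Measure.smul_apply,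
      Measure.map_apply (measurable_consB _) (hpi hA),
      Measure.map_apply (measurable_consB _) (hpi hA), smul_eq_mul, smul_eq_mul]
    congr 3
    · ext a
      simp [projPi_consB]
    · ext a
      simp [projPi_consB]
  have hbig : m.map projPi (Set.Ioi goldenMean) = 0 := by
    rw [Measure.map_apply hpi measurableSet_Ioi]
    convert measure_empty (μ := m)
    ext a
    simpa using projPi_le a
  refine ⟨?_, hprob, self, ?_, ?_⟩
  · norm_num
  · rw [Measure.map_apply hpi measurableSet_Iio]
    convert measure_empty (μ := m)
    ext a
    simpa using projPi_nonneg a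
  · rw [← Set.Ioi_union_left]
    refine measure_union_null hbig ?_
    have h1 := self {goldenMean} (measurableSet_singleton _)
    have e0 : m.map projPi {z | z / goldenMean ∈ ({goldenMean} : Set ℝ)} = 0 := by
      refine measure_mono_null (fun z hz => ?_) hbig
      simp only [Set.mem_ofPred_eq, Set.mem_singleton_iff] at hz
      rw [div_eq_iff hp.ne'] at hz
      simp only [Set.mem_Ioi]
      nlinarith
    have e1 : {z | (z + 1) / goldenMean ∈ ({goldenMean} : Set ℝ)} = {goldenMean} := by
      ext z
      simp only [Set.mem_ofPred_eq, Set.mem_singleton_iff]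
      rw [div_eq_iff hp.ne', ← sq, gm_sq]
      constructor <;> intro h <;> linarith
    rw [e0, e1, mul_zero, zero_add, hcoe] at h1
    by_contra hne
    have hlt : (1 / 2 : ENNReal) * m.map projPi {goldenMean} < 1 * m.map projPi {goldenMean} :=
      ENNReal.mul_lt_mul_left hne (measure_ne_top _ _) (by simp)
    rw [one_mul] at hlt
    exact absurd h1 hlt.ne'

end bern

theorem bernoulliConvolution_singular (m : Measure (ℕ → Fin 2))
    (hm : IsBernoulliHalf m) :
    m.map projPi (freqSet (5 / 18)) = 1 ∧
      volume (Set.Icc (0 : ℝ) (1 / (goldenMean - 1)) \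
        freqSet (1 / (goldenMean ^ 2 + 1))) = 0 ∧
      (5 : ℝ) / 18 ≠ 1 / (goldenMean ^ 2 + 1) ∧
      (m.map projPi) ⟂ₘ volume := by
  have hp := gm_pos
  have := hm.1
  have hG := goodNu m hm
  have hprob := hG.prob
  have hIcc : ∀ γ x, x ∈ freqSet γ ↔ x ∈ Set.Icc 0 goldenMean ∧ HasFreq γ x := by
    intro γ x
    unfold freqSet HasFreq
    rw [gm_inv']
    rfl
  have hne : (5 : ℝ) / 18 ≠ 1 / (goldenMean ^ 2 + 1) := by
    rw [gm_sq]
    intro h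
    have h1 := gm_gt'
    have h2 := gm_lt
    field_simp at h
    linarith
  have hν : ∀ᵐ x ∂(m.map projPi), x ∈ freqSet (5 / 18) := by
    have a1 : ∀ᵐ x ∂(m.map projPi), x ∉ Set.Ici goldenMean := by
      exact measure_eq_zero_iff_ae_notMem.1 hG.big
    have a2 : ∀ᵐ x ∂(m.map projPi), x ∉ Set.Iio 0 := by
      exact measure_eq_zero_iff_ae_notMem.1 hG.neg
    filter_upwards [a1, a2, nu_freq hG] with x h1 h2 h3
    have h1' : x < goldenMean := not_le.1 h1
    have h2' : 0 ≤ x := not_lt.1 h2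
    rw [hIcc]
    exact ⟨⟨h2', h1'.le⟩, h3 ⟨h2', h1'⟩⟩
  have hL : volume (Set.Icc (0 : ℝ) (1 / (goldenMean - 1)) \
      freqSet (1 / (goldenMean ^ 2 + 1))) = 0 := by
    rw [gm_inv', measure_eq_zero_iff_ae_notMem]
    have a1 : ∀ᵐ x ∂(volume : Measure ℝ), x ≠ goldenMean := by
      rw [ae_iff]; simp
    filter_upwards [a1, lebesgue_freq] with x h1 h2 h3
    exact h3.2 ((hIcc _ _).2 ⟨h3.1, h2 ⟨h3.1.1, lt_of_le_of_ne h3.1.2 h1⟩⟩)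
  refine ⟨?_, hL, hne, ?_⟩
  · exact (measure_congr (eventuallyEq_univ.2 hν)).trans measure_univ
  · refine Measure.MutuallySingular.mk (s := (freqSet (5 / 18))ᶜ) (t := freqSet (5 / 18)) hν ?_
      (by simp)
    refine measure_mono_null (fun x hx => ?_) hL
    refine ⟨hx.1, fun hx2 => hne (tendsto_nhds_unique hx.2 hx2.2)⟩
end

section
/- Let β = (1+√5)/2. If γ ≠ 1/(β²+1), then the set A_γ of points in [0, 1/(β−1)] whose greedy β-expansion has the digit 1 with limiting frequency γ has Hausdorff dimension strictly less than 1; consequently the golden-mean Bernoulli convolution ν_β satisfies dim_H(ν_β) ≤ dim_H(A_{5/18}) < 1. -/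
open MeasureTheory Filter

namespace GM

local notation "β" => goldenMean

lemma sq_eq : β ^ 2 = β + 1 := by
  unfold goldenMean
  have : Real.sqrt 5 ^ 2 = 5 := Real.sq_sqrt (by norm_num)
  nlinarith

lemma one_lt : 1 < β := by
  unfold goldenMean
  have : (2:ℝ) < Real.sqrt 5 := by
    rw [Real.lt_sqrt] <;> norm_num
  linarith

lemma lt_two : β < 2 := by
  have := sq_eq
  have := one_lt
  nlinarith

lemma pos : 0 < β := by linarith [one_lt]

lemma inv_eq : 1 / β = β - 1 := by
  have := pos
  have := sq_eq
  field_simp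
  nlinarith

lemma inv_eq' : 1 / (β - 1) = β := by
  have := one_lt
  have := sq_eq
  have h : β - 1 ≠ 0 := by linarith
  field_simp
  nlinarith

/-- number of ones among the first N greedy digits -/
noncomputable def S (x : ℝ) (N : ℕ) : ℝ := ∑ k ∈ Finset.range N, greedyDigit x k

lemma digit_succ (x : ℝ) (k : ℕ) : greedyDigit x (k + 1) = greedyDigit (greedyT x) k := by
  simp [greedyDigit, Function.iterate_succ_apply]

lemma S_succ' (x : ℝ) (N : ℕ) : S x (N + 1) = greedyDigit x 0 + S (greedyT x) N := by
  unfold S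
  rw [Finset.sum_range_succ', add_comm]
  simp [digit_succ]

lemma digit_nonneg (x : ℝ) (k : ℕ) : 0 ≤ greedyDigit x k := by
  unfold greedyDigit; split_ifs <;> norm_num

def Freq (γ x : ℝ) : Prop := Tendsto (fun N : ℕ => S x N / N) atTop (nhds γ)

lemma freq_T (γ x : ℝ) : Freq γ x ↔ Freq γ (greedyT x) := by
  unfold Freq
  rw [← tendsto_add_atTop_iff_nat (f := fun N : ℕ => S x N / N) 1]
  have h1 : Tendsto (fun N : ℕ => ((N : ℝ) + 1) / N) atTop (nhds 1) := by
    have := (tendsto_const_nhds (x := (1:ℝ)) (f := atTop)).add (tendsto_one_div_atTop_nhds_zero_nat (𝕜 := ℝ))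
    rw [add_zero] at this
    refine this.congr' ?_
    filter_upwards [eventually_gt_atTop 0] with N hN
    have : (N : ℝ) ≠ 0 := by positivity
    field_simp
  have h2 : Tendsto (fun N : ℕ => (N : ℝ) / (N + 1)) atTop (nhds 1) :=
    tendsto_natCast_div_add_atTop (1:ℝ)
  have h3 : Tendsto (fun N : ℕ => greedyDigit x 0 / (N : ℝ)) atTop (nhds 0) :=
    tendsto_const_div_atTop_nhds_zero_nat _
  have h4 : Tendsto (fun N : ℕ => greedyDigit x 0 / ((N : ℝ) + 1)) atTop (nhds 0) := by
    have := (tendsto_add_atTop_iff_nat 1).2 h3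
    simpa using this
  constructor
  · intro h
    have := (h.mul h1).sub h3
    rw [mul_one, sub_zero] at this
    refine this.congr' ?_
    filter_upwards [eventually_gt_atTop 0] with N hN
    have : (N : ℝ) ≠ 0 := by positivity
    have : (N : ℝ) + 1 ≠ 0 := by positivity
    rw [S_succ']
    push_cast
    field_simp
    ring
  · intro h
    have := (h.mul h2).add h4
    rw [mul_one, add_zero] at this
    refine this.congr' ?_
    filter_upwards [eventually_gt_atTop 0] with N hN
    have : (N : ℝ) ≠ 0 := by positivity
    have : (N : ℝ) + 1 ≠ 0 := by positivity
    rw [S_succ']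
    push_cast
    field_simp
    ring

lemma freq_iter (γ x : ℝ) (k : ℕ) : Freq γ x ↔ Freq γ (greedyT^[k] x) := by
  induction k generalizing x with
  | zero => simp
  | succ k ih => rw [Function.iterate_succ_apply, ← ih, freq_T]

lemma T_mem {x : ℝ} (h : x ∈ Set.Ico (0:ℝ) 1) : greedyT x ∈ Set.Ico (0:ℝ) 1 := by
  have h1 := one_lt
  have h2 := sq_eq
  obtain ⟨h0, h3⟩ := h
  unfold greedyT
  rw [inv_eq]
  split_ifs with h
  · constructor <;> nlinarith
  · constructor <;> nlinarith

lemma T_iter_mem {x : ℝ} (h : x ∈ Set.Ico (0:ℝ) 1) (k : ℕ) :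
    greedyT^[k] x ∈ Set.Ico (0:ℝ) 1 := by
  induction k with
  | zero => simpa
  | succ k ih => rw [Function.iterate_succ_apply']; exact T_mem ih

/-! ### weights of words -/

noncomputable def v (l : ℝ) : Bool → ℝ := fun p => if p then 1 else l

/-- Unnormalized Parry-type weight of a word, given the preceding letter. -/
noncomputable def u (l t : ℝ) : (n : ℕ) → Bool → (Fin n → Bool) → ℝ
  | 0, p, _ => v l p
  | n + 1, p, w => (if p && w 0 then 0 else (if w 0 then Real.exp t else 1) / l) *
      u l t n (w 0) (Fin.tail w)

lemma u_sum (l t : ℝ) (hl : 1 < l) (h : l ^ 2 = l + Real.exp t) (n : ℕ) (p : Bool) :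
    ∑ w, u l t n p w = v l p := by
  induction n generalizing p with
  | zero => simp [u]
  | succ n ih =>
    rw [← (Fin.consEquiv (fun _ : Fin (n+1) => Bool)).sum_comp, Fintype.sum_prod_type]
    have e : ∀ (b : Bool) (i : Fin n → Bool),
      Fin.tail ((Fin.consEquiv (fun _ : Fin (n+1) => Bool)) (b, i)) = i := fun _ _ => rfl
    have e0 : ∀ (b : Bool) (i : Fin n → Bool),
      ((Fin.consEquiv (fun _ : Fin (n+1) => Bool)) (b, i)) 0 = b := fun _ _ => rfl
    simp only [u, e, e0, ← Finset.mul_sum, ih]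
    have : l ≠ 0 := by positivity
    cases p <;> simp [v] <;> field_simp <;> nlinarith

lemma u_nonneg (l t : ℝ) (hl : 1 < l) (n : ℕ) (p : Bool) (w) : 0 ≤ u l t n p w := by
  induction n generalizing p with
  | zero => simp only [u, v]; split_ifs <;> linarith
  | succ n ih =>
    have : 0 < l := by linarith
    have := ih (w 0) (Fin.tail w)
    simp only [u]
    split_ifs <;> positivity

/-- the word of the first `n` digits -/
noncomputable def wd (x : ℝ) (n : ℕ) : Fin n → Bool :=
  fun i => decide (1 / β ≤ greedyT^[i] x)

lemma wd_tail (x : ℝ) (n : ℕ) : Fin.tail (wd x (n + 1)) = wd (greedyT x) n := by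
  funext i
  simp [wd, Fin.tail]

lemma u_ge (l t : ℝ) (hl : 1 < l) (n : ℕ) (p : Bool) {x : ℝ} (hx : x ∈ Set.Ico (0:ℝ) 1)
    (hp : p = true → x < 1 / β) : Real.exp (t * S x n) / l ^ n ≤ u l t n p (wd x n) := by
  induction n generalizing p x with
  | zero => simp only [S, u, v]; split_ifs <;> simp; linarith
  | succ n ih =>
    simp only [u]
    rw [wd_tail, S_succ']
    have hw : wd x (n+1) 0 = decide (1 / β ≤ x) := by simp [wd]
    rw [hw]
    have hl0 : 0 < l := by linarith
    by_cases hd : 1 / β ≤ x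
    · have hpf : p = false := by
        cases p
        · rfl
        · exact absurd (hp rfl) (not_lt.2 hd)
      have := ih true (T_mem hx) (fun _ => by
        have h1 := one_lt
        have h2 := inv_eq
        rw [greedyT, if_neg (not_lt.2 hd), h2]
        nlinarith [hx.2])
      simp only [hpf, hd, decide_true, greedyDigit, Function.iterate_zero, id, if_true]
      calc _ = Real.exp t / l * (Real.exp (t * S (greedyT x) n) / l ^ n) := by
            rw [mul_add, Real.exp_add, mul_one, pow_succ]; field_simp
        _ ≤ _ := by simpa using mul_le_mul_of_nonneg_left this (by positivity)
    · have := ih false (T_mem hx) (by simp)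
      simp only [hd, decide_false, greedyDigit, Function.iterate_zero, id, if_false]
      calc _ = 1 / l * (Real.exp (t * S (greedyT x) n) / l ^ n) := by
            rw [zero_add, pow_succ]; field_simp
        _ ≤ _ := by simpa using mul_le_mul_of_nonneg_left this (by positivity : 0 ≤ 1 / l)

lemma dist_eq (n : ℕ) {x y : ℝ} (h : wd x n = wd y n) :
    greedyT^[n] x - greedyT^[n] y = β ^ n * (x - y) := by
  induction n generalizing x y with
  | zero => simp
  | succ n ih =>
    have h1 : wd (greedyT x) n = wd (greedyT y) n := by rw [← wd_tail, ← wd_tail, h]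
    have h0 : wd x (n+1) 0 = wd y (n+1) 0 := by rw [h]
    rw [Function.iterate_succ_apply, Function.iterate_succ_apply, ih h1]
    replace h0 : 1 / β ≤ x ↔ 1 / β ≤ y := by simpa [wd] using h0
    have : greedyT x - greedyT y = β * (x - y) := by
      unfold greedyT
      by_cases hx : 1 / β ≤ x
      · rw [if_neg (not_lt.2 hx), if_neg (not_lt.2 (h0.1 hx))]; ring
      · rw [if_pos (not_le.1 hx), if_pos (not_le.1 (fun hy => hx (h0.2 hy)))]; ring
    rw [this]; ring

lemma dist_le (n : ℕ) {x y : ℝ} (hx : x ∈ Set.Ico (0:ℝ) 1) (hy : y ∈ Set.Ico (0:ℝ) 1)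
    (h : wd x n = wd y n) : dist x y ≤ (β ^ n)⁻¹ := by
  have h1 := dist_eq n h
  have hp : 0 < β ^ n := pow_pos pos n
  have h2 := T_iter_mem hx n
  have h3 := T_iter_mem hy n
  rw [Real.dist_eq, ← one_div, le_div_iff₀ hp, ← abs_of_pos hp, ← abs_mul, mul_comm, ← h1, abs_le]
  constructor <;> linarith [h2.1, h2.2, h3.1, h3.2]

def EM (t α : ℝ) (M : ℕ) : Set ℝ :=
  {x | x ∈ Set.Ico (0:ℝ) 1 ∧ ∀ N ≥ M, Real.exp (α * N) ≤ Real.exp (t * S x N)}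

lemma exists_l (γ : ℝ) (hγ : γ ≠ 1 / (β ^ 2 + 1)) :
    ∃ l t : ℝ, 1 < l ∧ l ^ 2 = l + Real.exp t ∧ Real.log l - γ * t < Real.log β := by
  have h1 := one_lt
  have h2 := sq_eq
  by_contra! hc
  have hmin : IsLocalMin (fun l : ℝ => Real.log l - γ * Real.log (l ^ 2 - l)) β := by
    filter_upwards [lt_mem_nhds h1] with l hl
    have hp : 0 < l ^ 2 - l := by nlinarith
    have := hc l (Real.log (l ^ 2 - l)) hl (by rw [Real.exp_log hp]; ring)
    simpa [h2] using this
  have hd : HasDerivAt (fun l : ℝ => Real.log l - γ * Real.log (l ^ 2 - l))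
      (1 / β - γ * ((2 * β - 1) / (β ^ 2 - β))) β := by
    have ha : HasDerivAt (fun l : ℝ => l) 1 β := hasDerivAt_id β
    have hb : HasDerivAt (fun l : ℝ => l ^ 2 - l) (2 * β - 1) β := by
      have := (ha.pow 2).sub ha
      simp only [Nat.cast_ofNat, Nat.add_one_sub_one, pow_one, mul_one] at this
      exact this
    exact (ha.log (by linarith)).sub ((hb.log (by rw [h2]; norm_num)).const_mul γ)
  have h0 := hmin.hasDerivAt_eq_zero hd
  apply hγ
  have : β ^ 2 - β = 1 := by linarith
  rw [this, div_one, sub_eq_zero, div_eq_iff (by linarith)] at h0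
  rw [eq_div_iff (by nlinarith), h0]
  ring_nf
  nlinarith

lemma dimH_EM (l t α s : ℝ) (hl : 1 < l) (h : l ^ 2 = l + Real.exp t) (hs0 : 0 < s)
    (hs : l * Real.exp (-α) < β ^ s) (M : ℕ) : dimH (EM t α M) ≤ ENNReal.ofReal s := by
  have h1 := one_lt
  have hl0 : 0 < l := by linarith
  set r : ℝ := l * Real.exp (-α) / β ^ s with hr
  have hbs : 0 < β ^ s := Real.rpow_pos_of_pos pos s
  have hr0 : 0 ≤ r := by positivity
  have hr1 : r < 1 := (div_lt_one hbs).2 hs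
  have key : Measure.hausdorffMeasure s (EM t α M) ≤ 0 := by
    have hlim : Tendsto (fun n : ℕ => ENNReal.ofReal (l * r ^ n)) atTop (nhds 0) := by
      rw [← ENNReal.ofReal_zero]
      apply ENNReal.tendsto_ofReal
      simpa using (tendsto_pow_atTop_nhds_zero_of_lt_one hr0 hr1).const_mul l
    have hlim2 : Tendsto (fun n : ℕ => ENNReal.ofReal ((β ^ n)⁻¹)) atTop (nhds 0) := by
      rw [← ENNReal.ofReal_zero]
      apply ENNReal.tendsto_ofReal
      exact tendsto_inv_atTop_zero.comp (tendsto_pow_atTop_atTop_of_one_lt h1)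
    have hdiam : ∀ (n : ℕ) (w : Fin n → Bool),
        Metric.ediam {x | x ∈ EM t α M ∧ wd x n = w} ≤ ENNReal.ofReal ((β ^ n)⁻¹) := by
      intro n w
      apply Metric.ediam_le
      rintro x ⟨hx, hxw⟩ y ⟨hy, hyw⟩
      rw [edist_dist]
      exact ENNReal.ofReal_le_ofReal (dist_le n hx.1 hy.1 (hxw.trans hyw.symm))
    refine (Measure.hausdorffMeasure_le_liminf_sum (l := atTop) s (EM t α M)
      (fun n : ℕ => ENNReal.ofReal ((β ^ n)⁻¹)) hlim2
      (fun n (w : Fin n → Bool) => {x | x ∈ EM t α M ∧ wd x n = w})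
      (Eventually.of_forall hdiam) ?_).trans ?_
    · refine Eventually.of_forall fun n x hx => ?_
      simp only [Set.mem_iUnion, Set.mem_ofPred_eq]
      exact ⟨_, hx, rfl⟩
    · rw [← hlim.liminf_eq]
      refine liminf_le_liminf ?_
      filter_upwards [eventually_ge_atTop M] with n hn
      calc _ ≤ ∑ w : Fin n → Bool, ENNReal.ofReal (u l t n false w * r ^ n) := by
            refine Finset.sum_le_sum fun w _ => ?_
            rcases Set.eq_empty_or_nonempty {x | x ∈ EM t α M ∧ wd x n = w} with he | ⟨x, hx, hxw⟩
            · rw [he]; simp [hs0]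
            · refine (ENNReal.rpow_le_rpow (hdiam n w) hs0.le).trans ?_
              rw [ENNReal.ofReal_rpow_of_pos (by have := pos; positivity)]
              apply ENNReal.ofReal_le_ofReal
              have hu := u_ge l t hl n false hx.1 (by simp)
              rw [hxw] at hu
              have hx2 := hx.2 n hn
              have e1 : (((β : ℝ) ^ n)⁻¹) ^ s = ((β ^ s) ^ n)⁻¹ := by
                rw [Real.inv_rpow (by have := pos; positivity), ← Real.rpow_natCast,
                  ← Real.rpow_natCast, ← Real.rpow_mul pos.le, ← Real.rpow_mul pos.le, mul_comm]
              rw [e1, hr, div_pow, mul_pow, ← Real.exp_nat_mul]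
              have e2 : Real.exp (α * n) / l ^ n ≤ u l t n false w :=
                (div_le_div_of_nonneg_right hx2 (by positivity)).trans hu
              calc ((β ^ s) ^ n)⁻¹ = (Real.exp (α * n) / l ^ n) *
                    (l ^ n * Real.exp (n * -α) / (β ^ s) ^ n) := by
                    have : Real.exp (n * -α) = (Real.exp (α * n))⁻¹ := by
                      rw [← Real.exp_neg]; ring_nf
                    rw [this]
                    field_simp
                _ ≤ _ := mul_le_mul_of_nonneg_right e2 (by positivity)
        _ = ENNReal.ofReal (l * r ^ n) := by
            rw [← ENNReal.ofReal_sum_of_nonneg, ← Finset.sum_mul, u_sum l t hl h]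
            · simp [v]
            · intro w _
              exact mul_nonneg (u_nonneg l t hl n _ w) (by positivity)
  have := dimH_le_of_hausdorffMeasure_ne_top (s := EM t α M) (d := s.toNNReal) (by
    rw [Real.coe_toNNReal _ hs0.le, le_antisymm key (zero_le)]; simp)
  simpa [ENNReal.ofReal] using this

noncomputable def g (y : ℝ) : ℝ := (y + 1) / β

lemma g_lip (k : ℕ) : LipschitzWith 1 (g^[k]) := by
  have : LipschitzWith 1 g := by
    apply LipschitzWith.of_dist_le_mul
    intro x y
    have h1 := one_lt
    rw [Real.dist_eq, Real.dist_eq]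
    have : g x - g y = (x - y) / β := by unfold g; ring
    rw [this, abs_div, abs_of_pos pos, NNReal.coe_one, one_mul]
    exact div_le_self (abs_nonneg _) h1.le
  simpa using this.iterate k

lemma g_T {x : ℝ} (k : ℕ) (h : ∀ j < k, 1 ≤ greedyT^[j] x) : g^[k] (greedyT^[k] x) = x := by
  induction k generalizing x with
  | zero => simp
  | succ k ih =>
    rw [Function.iterate_succ_apply', Function.iterate_succ_apply, ih]
    · have h0 := h 0 (by omega)
      simp only [Function.iterate_zero, id] at h0
      have := inv_eq
      have := lt_two
      have := pos
      rw [greedyT, if_neg (by linarith), g]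
      field_simp
      ring
    · intro j hj
      rw [← Function.iterate_succ_apply]
      exact h _ (by omega)

lemma exists_entry {x : ℝ} (hx0 : 0 ≤ x) (hx : x < β) : 
    ∃ k, greedyT^[k] x ∈ Set.Ico (0:ℝ) 1 ∧ ∀ j < k, 1 ≤ greedyT^[j] x := by
  have h1 := one_lt
  have h2 := sq_eq
  have h4 := inv_eq
  have h5 := lt_two
  have hex : ∃ k, greedyT^[k] x < 1 := by
    by_contra! hc
    have h3 : ∀ k, β - greedyT^[k] x = β ^ k * (β - x) := by
      intro k
      induction k with
      | zero => simp
      | succ k ih =>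
        rw [Function.iterate_succ_apply', greedyT, if_neg (by linarith [hc k]), pow_succ]
        linear_combination β * ih - h2
    obtain ⟨k, hk⟩ := ((tendsto_pow_atTop_atTop_of_one_lt h1).eventually_gt_atTop (1 / (β - x))).exists
    have := hc k
    have := h3 k
    rw [div_lt_iff₀ (by linarith)] at hk
    linarith
  classical
  refine ⟨Nat.find hex, ⟨?_, Nat.find_spec hex⟩, fun j hj => not_lt.1 (Nat.find_min hex hj)⟩
  rcases hk : Nat.find hex with _ | k
  · simpa
  · have := not_lt.1 (Nat.find_min hex (by omega : k < Nat.find hex))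
    rw [Function.iterate_succ_apply', greedyT, if_neg (by linarith)]
    nlinarith

theorem part1 (γ : ℝ) (hγ : γ ≠ 1 / (β ^ 2 + 1)) : dimH (freqSet γ) < 1 := by
  obtain ⟨l, t, hl, h, hlt⟩ := exists_l γ hγ
  have hβ := pos
  have hl0 : 0 < l := by linarith
  obtain ⟨δ, hδ0, hδ⟩ : ∃ δ > 0, Real.log l - (γ * t - δ) < Real.log β :=
    ⟨(Real.log β - (Real.log l - γ * t)) / 2, by linarith, by linarith⟩
  set α := γ * t - δ with hα
  have hk : l * Real.exp (-α) < β := by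
    rw [← Real.exp_log hl0, ← Real.exp_add, ← Real.lt_log_iff_exp_lt hβ]
    linarith
  obtain ⟨s, hs, hs0, hs1⟩ : ∃ s : ℝ, l * Real.exp (-α) < β ^ s ∧ 0 < s ∧ s < 1 := by
    have hc : Tendsto (fun s : ℝ => β ^ s) (nhdsWithin 1 (Set.Iio 1)) (nhds (β ^ (1:ℝ))) :=
      (Real.continuousAt_const_rpow hβ.ne').tendsto.mono_left nhdsWithin_le_nhds
    rw [Real.rpow_one] at hc
    have e1 := hc.eventually (lt_mem_nhds hk)
    have e2 : ∀ᶠ s : ℝ in nhdsWithin 1 (Set.Iio 1), 0 < s :=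
      nhdsWithin_le_nhds (lt_mem_nhds (by norm_num))
    have e3 : ∀ᶠ s : ℝ in nhdsWithin 1 (Set.Iio 1), s < 1 := self_mem_nhdsWithin
    obtain ⟨s, a, b, c⟩ := (e1.and (e2.and e3)).exists
    exact ⟨s, a, b, c⟩
  have hsub : freqSet γ ⊆ {β} ∪ ⋃ k : ℕ, ⋃ M : ℕ, g^[k] '' EM t α M := by
    rintro x ⟨⟨hx0, hx1⟩, hx⟩
    rw [inv_eq'] at hx1
    rcases eq_or_lt_of_le hx1 with he | hlt
    · left; exact he
    right
    obtain ⟨k, hk1, hk2⟩ := exists_entry hx0 hlt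
    have hf : Freq γ (greedyT^[k] x) := (freq_iter γ x k).1 hx
    have hev := (hf.mul_const t).eventually (lt_mem_nhds (by linarith : α < γ * t))
    obtain ⟨M, hM⟩ := eventually_atTop.1 (hev.and (eventually_gt_atTop 0))
    simp only [Set.mem_iUnion]
    refine ⟨k, M, greedyT^[k] x, ⟨hk1, fun N hN => ?_⟩, g_T k hk2⟩
    obtain ⟨a, b⟩ := hM N hN
    apply Real.exp_le_exp.2
    have : (0:ℝ) < N := by exact_mod_cast b
    rw [div_mul_eq_mul_div, lt_div_iff₀ this] at a
    linarith
  refine (dimH_mono hsub).trans_lt ?_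
  rw [dimH_union, dimH_singleton, dimH_iUnion]
  refine lt_of_le_of_lt (b := ENNReal.ofReal s) ?_ (by simpa using hs1)
  refine max_le (zero_le) (iSup_le fun k => ?_)
  rw [dimH_iUnion]
  exact iSup_le fun M => ((g_lip k).dimH_image_le _).trans (dimH_EM l t α s hl h hs0 hs M)


/-! ### Normalization transducer and the frequency 5/18 -/

def sh (a : ℕ → Fin 2) (n : ℕ) : ℕ → Fin 2 := fun i => a (i + n)

lemma term_eq (n : ℕ) : β ^ (-((n : ℤ) + 1)) = β⁻¹ * β⁻¹ ^ n := by
  rw [zpow_neg, zpow_add₀ pos.ne', zpow_one, zpow_natCast, mul_inv, inv_pow, mul_comm]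

lemma inv_lt_one : β⁻¹ < 1 := inv_lt_one_of_one_lt₀ one_lt

lemma summable_geo : Summable (fun n : ℕ => β ^ (-((n : ℤ) + 1))) := by
  simp only [term_eq]
  exact (summable_geometric_of_lt_one (inv_nonneg.2 pos.le) inv_lt_one).mul_left _

lemma tsum_geo : ∑' n : ℕ, β ^ (-((n : ℤ) + 1)) = β := by
  simp only [term_eq]
  rw [tsum_mul_left, tsum_geometric_of_lt_one (inv_nonneg.2 pos.le) inv_lt_one, ← mul_inv]
  have := inv_eq'
  have h := pos.ne'
  have : β * (1 - β⁻¹) = β - 1 := by field_simp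
  rw [this, ← one_div, inv_eq']

lemma fin2_le (i : Fin 2) : ((i : ℕ) : ℝ) ≤ 1 := by
  exact_mod_cast Nat.le_of_lt_succ i.2

lemma summable_proj (a : ℕ → Fin 2) :
    Summable (fun n : ℕ => ((a n : ℕ) : ℝ) * β ^ (-((n : ℤ) + 1))) := by
  have := pos
  refine Summable.of_nonneg_of_le (fun n => by positivity) (fun n => ?_) summable_geo
  exact mul_le_of_le_one_left (by positivity) (fin2_le _)

lemma proj_nonneg (a : ℕ → Fin 2) : 0 ≤ projPi a := by
  have := pos
  exact tsum_nonneg fun n => by positivity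

lemma proj_le (a : ℕ → Fin 2) : projPi a ≤ β := by
  have := pos
  rw [← tsum_geo]
  exact (summable_proj a).tsum_le_tsum
    (fun n => mul_le_of_le_one_left (by positivity) (fin2_le _)) summable_geo

lemma proj_cons (a : ℕ → Fin 2) : β * projPi a = ((a 0 : ℕ) : ℝ) + projPi (sh a 1) := by
  have h := pos.ne'
  unfold projPi
  rw [(summable_proj a).tsum_eq_zero_add, mul_add, ← tsum_mul_left]
  congr 1
  · simp; field_simp
  · refine tsum_congr fun n => ?_
    rw [term_eq, term_eq]
    simp only [sh, pow_succ]
    field_simp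

lemma sh_sh (a : ℕ → Fin 2) (n : ℕ) : sh (sh a n) 1 = sh a (n + 1) := by
  funext i; simp only [sh]; congr 1; omega

lemma sh_zero (a : ℕ → Fin 2) : sh a 0 = a := rfl

lemma proj_cons' (a : ℕ → Fin 2) (n : ℕ) :
    β * projPi (sh a n) = ((a n : ℕ) : ℝ) + projPi (sh a (n + 1)) := by
  rw [proj_cons, sh_sh]; simp [sh]

lemma proj_lt (a : ℕ → Fin 2) (k : ℕ) (hk : a k = 0) : projPi a < β := by
  induction k generalizing a with
  | zero =>
    have h := proj_cons a
    have h1 := one_lt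
    have h2 := proj_le (sh a 1)
    have h3 := sq_eq
    rw [hk] at h
    simp at h
    nlinarith
  | succ k ih =>
    have h := proj_cons a
    have h1 := one_lt
    have h2 := ih (sh a 1) hk
    have h3 := sq_eq
    have h4 := fin2_le (a 0)
    nlinarith

abbrev Y := Bool × ℕ × ℝ

noncomputable def step : Y → Fin 2 → Y := fun y i =>
  if y.1 then
    (if i = 0 then (false, y.2.1, y.2.2) else (false, 0, y.2.2 + 1 - y.2.1))
  else
    (if i = 0 then (false, 0, y.2.2) else (true, y.2.1 + 1, y.2.2 + 1))

noncomputable def run (a : ℕ → Fin 2) : ℕ → Y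
  | 0 => (false, 0, 0)
  | n + 1 => step (run a n) (a n)

def Inv (x : ℝ) (a : ℕ → Fin 2) (N : ℕ) (y : Y) : Prop :=
  (y.1 = false ∧ greedyT^[N] x = projPi (sh a N) ∧ S x N = y.2.2) ∨
  (y.1 = false ∧ greedyT^[N] x = projPi (sh a N) - 1 ∧ S x N = y.2.2 + 1 - y.2.1) ∨
  (y.1 = true ∧ greedyT^[N] x = projPi (sh a N) ∧ S x N = y.2.2 ∧ greedyT^[N] x < 1 / β) ∨
  (y.1 = true ∧ greedyT^[N] x = projPi (sh a N) + 1 - β ∧ S x N = y.2.2 + 1 - y.2.1)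

lemma fin2_cases (i : Fin 2) : i = 0 ∨ i = 1 := by omega

set_option maxHeartbeats 2000000 in
lemma inv_run (a : ℕ → Fin 2) (h : projPi a < 1) (ha : ∀ n, projPi (sh a n) < β) (N : ℕ) :
    Inv (projPi a) a N (run a N) := by
  induction N with
  | zero => left; simp [run, sh_zero, S]
  | succ N ih =>
    set x := projPi a with hx
    have hb := one_lt
    have hb2 := lt_two
    have hsq := sq_eq
    have hinv := inv_eq
    have hxm : x ∈ Set.Ico (0:ℝ) 1 := ⟨proj_nonneg a, h⟩
    have hy := T_iter_mem hxm N
    have hy' := T_iter_mem hxm (N + 1)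
    have hp0 := proj_nonneg (sh a (N + 1))
    have hp1 := ha (N + 1)
    have hc := proj_cons' a N
    have hS : S x (N + 1) = S x N + greedyDigit x N := by
      unfold S; rw [Finset.sum_range_succ]
    rw [Function.iterate_succ_apply'] at hy'
    unfold Inv at ih ⊢
    rw [Function.iterate_succ_apply', hS]
    simp only [run, greedyDigit]
    generalize greedyT^[N] x = z at *
    generalize S x N = s at *
    generalize run a N = yy at *
    obtain ⟨q, k, c⟩ := yy
    simp only at ih
    obtain ⟨hz0, hz1⟩ := hy
    by_cases hd : 1 / β ≤ z
    · have hT : greedyT z = β * z - 1 := by rw [greedyT, if_neg (not_lt.2 hd)]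
      rw [hT] at hy' ⊢
      obtain ⟨hy0, hy1⟩ := hy'
      rw [if_pos hd]
      rw [hinv] at *
      rcases fin2_cases (a N) with h0 | h0 <;> rw [h0] at hc ⊢ <;>
      rcases ih with ⟨rfl, h1, h2⟩ | ⟨rfl, h1, h2⟩ | ⟨rfl, h1, h2, h3⟩ | ⟨rfl, h1, h2⟩ <;>
      simp [step] at hc ⊢ <;> have hm := congrArg (fun t => β * t) h1
      · right; constructor <;> nlinarith
      · nlinarith
      · nlinarith
      · nlinarith
      · left; refine ⟨?_, ?_, ?_⟩ <;> nlinarith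
      · nlinarith
      · nlinarith
      · right; constructor <;> nlinarith
    · have hT : greedyT z = β * z := by rw [greedyT, if_pos (not_le.1 hd)]
      rw [hT] at hy' ⊢
      obtain ⟨hy0, hy1⟩ := hy'
      rw [if_neg hd]
      rw [hinv] at *
      rcases fin2_cases (a N) with h0 | h0 <;> rw [h0] at hc ⊢ <;>
      rcases ih with ⟨rfl, h1, h2⟩ | ⟨rfl, h1, h2⟩ | ⟨rfl, h1, h2, h3⟩ | ⟨rfl, h1, h2⟩ <;>
      simp [step] at hc ⊢ <;> have hm := congrArg (fun t => β * t) h1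
      · left; constructor <;> nlinarith
      · nlinarith
      · left; constructor <;> nlinarith
      · right; constructor <;> nlinarith
      · nlinarith
      · right; constructor <;> nlinarith
      · nlinarith
      · left; constructor <;> nlinarith

noncomputable def Mg (N : ℕ) (y : Y) : ℝ :=
  y.2.2 - 5 / 18 * N + (if y.1 then 2 / 9 - 2 / 3 * (y.2.1 : ℝ) else - ((y.2.1 : ℝ) / 3))

noncomputable def W (N : ℕ) (y : Y) : ℝ := Mg N y ^ 2 + (y.2.1 : ℝ) ^ 2

lemma W_step (N : ℕ) (y : Y) : W (N + 1) (step y 0) + W (N + 1) (step y 1) ≤ 2 * W N y + 4 := by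
  obtain ⟨q, k, c⟩ := y
  have hk : (0:ℝ) ≤ k := by positivity
  cases q
  · simp [W, Mg, step]
    nlinarith [sq_nonneg ((k : ℝ) - 1)]
  · simp [W, Mg, step]
    nlinarith [sq_nonneg ((k : ℝ) - 1)]

lemma S_bound {x : ℝ} {a : ℕ → Fin 2} {N : ℕ} {y : Y} (h : Inv x a N y) :
    |S x N - 5 / 18 * N| ≤ |Mg N y| + 2 * y.2.1 + 2 := by
  obtain ⟨q, k, c⟩ := y
  have hk : (0:ℝ) ≤ k := by positivity
  rcases h with ⟨h0, h1, h2⟩ | ⟨h0, h1, h2⟩ | ⟨h0, h1, h2, h3⟩ | ⟨h0, h1, h2⟩ <;>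
  · simp only at h0 h2
    subst h0
    rw [h2]
    simp only [Mg, if_true, Bool.false_eq_true, if_false]
    rw [abs_le]
    constructor
    · first
      | linarith [neg_abs_le (c - 5 / 18 * N + (2 / 9 - 2 / 3 * (k:ℝ)))]
      | linarith [neg_abs_le (c - 5 / 18 * N + - ((k:ℝ) / 3))]
    · first
      | linarith [le_abs_self (c - 5 / 18 * N + (2 / 9 - 2 / 3 * (k:ℝ)))]
      | linarith [le_abs_self (c - 5 / 18 * N + - ((k:ℝ) / 3))]

lemma freq_of_W {a : ℕ → Fin 2} (h : projPi a < 1) (ha : ∀ n, projPi (sh a n) < β)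
    (hW : Tendsto (fun j : ℕ => W (j ^ 2) (run a (j ^ 2)) / (j : ℝ) ^ 4) atTop (nhds 0)) :
    Freq (5 / 18) (projPi a) := by
  apply tendsto_div_of_monotone_of_exists_subseq_tendsto_div
  · apply monotone_nat_of_le_succ
    intro n
    unfold S
    rw [Finset.sum_range_succ]
    linarith [digit_nonneg (projPi a) n]
  intro r hr
  refine ⟨fun j => j ^ 2, ?_, tendsto_pow_atTop (by norm_num), ?_⟩
  · have h1 : Tendsto (fun N : ℕ => 1 + (1 / (N : ℝ))) atTop (nhds (1 + 0)) :=
      (tendsto_const_nhds (x := (1:ℝ)) (f := atTop)).add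
        (tendsto_one_div_atTop_nhds_zero_nat (𝕜 := ℝ))
    have h2 := h1.pow 2
    have h3 := h2.eventually (gt_mem_nhds (by simpa using hr : (1 + 0 : ℝ) ^ 2 < r))
    filter_upwards [h3, eventually_gt_atTop 0] with n hn hn0
    have hp : (0:ℝ) < n := by exact_mod_cast hn0
    push_cast
    have : ((n : ℝ) + 1) ^ 2 = (1 + 1 / (n:ℝ)) ^ 2 * n ^ 2 := by field_simp
    rw [this]
    exact mul_le_mul_of_nonneg_right hn.le (by positivity)
  · have hsq : Tendsto (fun j : ℕ => Real.sqrt (W (j ^ 2) (run a (j ^ 2)) / (j : ℝ) ^ 4))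
        atTop (nhds 0) := by simpa using hW.sqrt
    have h2 : Tendsto (fun j : ℕ => 2 / (j : ℝ)) atTop (nhds 0) :=
      tendsto_const_div_atTop_nhds_zero_nat _
    rw [tendsto_iff_norm_sub_tendsto_zero]
    refine squeeze_zero' (Eventually.of_forall fun _ => norm_nonneg _) ?_
      (by rw [show (0:ℝ) = 3 * 0 + 0 by norm_num]; exact (hsq.const_mul 3).add h2)
    filter_upwards [eventually_gt_atTop 0] with j hj
    have hj1 : (1:ℝ) ≤ j := by exact_mod_cast hj
    have hj0 : (0:ℝ) < j := by linarith
    have hb := S_bound (inv_run a h ha (j ^ 2))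
    set y := run a (j ^ 2)
    have e1 : Real.sqrt (W (j ^ 2) y / (j : ℝ) ^ 4) = Real.sqrt (W (j ^ 2) y) / j ^ 2 := by
      rw [Real.sqrt_div' _ (by positivity), show (j:ℝ) ^ 4 = (j ^ 2) ^ 2 by ring,
        Real.sqrt_sq (by positivity)]
    have m1 : |Mg (j ^ 2) y| ≤ Real.sqrt (W (j ^ 2) y) := by
      apply Real.abs_le_sqrt; unfold W; nlinarith [sq_nonneg (y.2.1 : ℝ)]
    have m2 : (y.2.1 : ℝ) ≤ Real.sqrt (W (j ^ 2) y) := by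
      apply Real.le_sqrt_of_sq_le; unfold W; nlinarith [sq_nonneg (Mg (j ^ 2) y)]
    rw [e1, Real.norm_eq_abs]
    push_cast at hb ⊢
    have e2 : S (projPi a) (j ^ 2) / (j:ℝ) ^ 2 - 5 / 18
        = (S (projPi a) (j ^ 2) - 5 / 18 * (j:ℝ) ^ 2) / j ^ 2 := by field_simp
    rw [e2, abs_div, abs_of_pos (by positivity : (0:ℝ) < (j:ℝ) ^ 2)]
    have e3 : (2:ℝ) / j = 2 * j / j ^ 2 := by field_simp
    rw [e3, ← mul_div_assoc, ← add_div]
    apply div_le_div_of_nonneg_right _ (by positivity)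
    linarith

/-! ### measure theory -/

noncomputable def runW : (n : ℕ) → (Fin n → Fin 2) → Y
  | 0, _ => (false, 0, 0)
  | n + 1, w => step (runW n (Fin.init w)) (w (Fin.last n))

lemma run_eq (a : ℕ → Fin 2) (n : ℕ) : run a n = runW n (fun i => a i) := by
  induction n with
  | zero => rfl
  | succ n ih => simp only [run, runW, ih]; rfl

lemma sum_W (n : ℕ) : ∑ w, W n (runW n w) ≤ 2 * n * 2 ^ n := by
  induction n with
  | zero => simp [runW, W, Mg]
  | succ n ih =>
    rw [← (Fin.snocEquiv (fun _ : Fin (n+1) => Fin 2)).sum_comp, Fintype.sum_prod_type_right]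
    have e : ∀ (b : Fin 2) (i : Fin n → Fin 2),
      runW (n+1) ((Fin.snocEquiv (fun _ : Fin (n+1) => Fin 2)) (b, i)) = step (runW n i) b := by
      intro b i
      simp [runW, Fin.snocEquiv]
    simp only [e, Fin.sum_univ_two]
    calc _ ≤ ∑ w : Fin n → Fin 2, (2 * W n (runW n w) + 4) :=
          Finset.sum_le_sum fun w _ => W_step n _
      _ ≤ _ := by
          rw [Finset.sum_add_distrib, ← Finset.mul_sum]
          simp
          rw [pow_succ]
          nlinarith

lemma W_nonneg (n : ℕ) (y : Y) : 0 ≤ W n y := by unfold W; positivity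

lemma restr_meas (n : ℕ) : Measurable (fun (a : ℕ → Fin 2) (i : Fin n) => a i) := by
  fun_prop

lemma meas_W (n : ℕ) : Measurable (fun a => ENNReal.ofReal (W n (run a n))) := by
  have : (fun a => ENNReal.ofReal (W n (run a n))) =
    (fun w => ENNReal.ofReal (W n (runW n w))) ∘ (fun (a : ℕ → Fin 2) (i : Fin n) => a i) := by
    funext a; simp [run_eq]
  rw [this]
  exact (measurable_of_finite _).comp (restr_meas n)

lemma lint_W (m : Measure (ℕ → Fin 2)) (hm : IsBernoulliHalf m) (n : ℕ) :
    ∫⁻ a, ENNReal.ofReal (W n (run a n)) ∂m ≤ ENNReal.ofReal (2 * n) := by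
  have hmap : ∫⁻ a, ENNReal.ofReal (W n (run a n)) ∂m =
      ∫⁻ w, ENNReal.ofReal (W n (runW n w)) ∂(m.map (fun a (i : Fin n) => a i)) := by
    rw [lintegral_map (measurable_of_finite _) (restr_meas n)]
    simp only [run_eq]
  rw [hmap, lintegral_fintype]
  have hs : ∀ w : Fin n → Fin 2, (m.map (fun a (i : Fin n) => a i)) {w} = ENNReal.ofReal ((1 / 2) ^ n) := by
    intro w
    rw [Measure.map_apply (restr_meas n) (measurableSet_singleton _)]
    have := hm.2 (Finset.range n) (fun i => if h : i < n then w ⟨i, h⟩ else 0)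
    rw [Finset.card_range] at this
    rw [ENNReal.ofReal_pow (by norm_num), ENNReal.ofReal_div_of_pos (by norm_num)]
    simp only [ENNReal.ofReal_one, ENNReal.ofReal_ofNat]
    rw [← this]
    congr 1
    ext a
    simp only [Set.mem_preimage, Set.mem_singleton_iff, Set.mem_ofPred_eq, Finset.mem_range]
    constructor
    · intro h i hi
      rw [dif_pos hi, ← h]
    · intro h
      funext i
      rw [h i i.2, dif_pos i.2]
  simp only [hs]
  rw [← Finset.sum_mul, ← ENNReal.ofReal_sum_of_nonneg (fun w _ => W_nonneg _ _),
    ← ENNReal.ofReal_mul (Finset.sum_nonneg fun w _ => W_nonneg _ _)]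
  apply ENNReal.ofReal_le_ofReal
  calc _ ≤ (2 * n * 2 ^ n) * (1 / 2 : ℝ) ^ n :=
        mul_le_mul_of_nonneg_right (sum_W n) (by positivity)
    _ = 2 * n := by rw [mul_assoc, ← mul_pow]; norm_num

lemma ae_W (m : Measure (ℕ → Fin 2)) (hm : IsBernoulliHalf m) :
    ∀ᵐ a ∂m, Tendsto (fun j : ℕ => W (j ^ 2) (run a (j ^ 2)) / (j : ℝ) ^ 4) atTop (nhds 0) := by
  have hmeas : ∀ j : ℕ, Measurable
      (fun a => ENNReal.ofReal (W (j ^ 2) (run a (j ^ 2))) * ENNReal.ofReal (1 / (j : ℝ) ^ 4)) :=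
    fun j => (meas_W _).mul_const _
  have hfin : ∫⁻ a, ∑' j : ℕ, ENNReal.ofReal (W (j ^ 2) (run a (j ^ 2))) *
      ENNReal.ofReal (1 / (j : ℝ) ^ 4) ∂m ≠ ⊤ := by
    rw [lintegral_tsum (fun j => (hmeas j).aemeasurable)]
    have hsum : Summable (fun j : ℕ => 2 * (1 / (j : ℝ) ^ 2)) :=
      (Real.summable_one_div_nat_pow.2 (by norm_num)).mul_left 2
    refine ne_top_of_le_ne_top hsum.tsum_ofReal_ne_top (ENNReal.tsum_le_tsum fun j => ?_)
    rw [lintegral_mul_const _ (meas_W _)]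
    refine (mul_le_mul_left (lint_W m hm (j ^ 2)) _).trans ?_
    rw [← ENNReal.ofReal_mul (by positivity)]
    apply ENNReal.ofReal_le_ofReal
    rcases Nat.eq_zero_or_pos j with rfl | hj
    · simp
    · push_cast
      apply le_of_eq
      field_simp
  filter_upwards [ae_lt_top (Measurable.tsum hmeas) hfin] with a ha
  have h0 := ENNReal.tendsto_atTop_zero_of_tsum_ne_top ha.ne
  have h1 := (ENNReal.tendsto_toReal ENNReal.zero_ne_top).comp h0
  simp only [ENNReal.toReal_zero] at h1
  refine h1.congr fun j => ?_
  simp only [Function.comp_apply, ENNReal.toReal_mul]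
  rw [ENNReal.toReal_ofReal (W_nonneg _ _), ENNReal.toReal_ofReal (by positivity)]
  ring

lemma sh_meas (n : ℕ) : Measurable (fun a : ℕ → Fin 2 => sh a n) := by
  unfold sh; fun_prop

lemma bern_sh (m : Measure (ℕ → Fin 2)) (hm : IsBernoulliHalf m) (n : ℕ) :
    IsBernoulliHalf (m.map (fun a => sh a n)) := by
  have := hm.1
  refine ⟨Measure.isProbabilityMeasure_map (sh_meas n).aemeasurable, fun s f => ?_⟩
  have hms : MeasurableSet {a : ℕ → Fin 2 | ∀ i ∈ s, a i = f i} := by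
    have : {a : ℕ → Fin 2 | ∀ i ∈ s, a i = f i} = ⋂ i ∈ s, (fun a => a i) ⁻¹' {f i} := by
      ext a; simp
    rw [this]
    exact Finset.measurableSet_biInter s fun i _ =>
      measurable_pi_apply i (measurableSet_singleton _)
  rw [Measure.map_apply (sh_meas n) hms]
  have := hm.2 (s.map (addRightEmbedding n)) (fun i => f (i - n))
  rw [Finset.card_map] at this
  rw [← this]
  congr 1
  ext a
  simp [sh]

lemma ae_zero (m : Measure (ℕ → Fin 2)) (hm : IsBernoulliHalf m) : ∀ᵐ a ∂m, ∃ k, a k = 0 := by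
  rw [ae_iff]
  have hle : ∀ n : ℕ, m {a | ¬ ∃ k, a k = 0} ≤ (1 / 2 : ENNReal) ^ n := by
    intro n
    have := hm.2 (Finset.range n) (fun _ => 1)
    rw [Finset.card_range] at this
    rw [← this]
    apply measure_mono
    intro a ha i _
    rcases fin2_cases (a i) with h | h
    · exact absurd ⟨i, h⟩ ha
    · exact h
  have : Tendsto (fun n : ℕ => (1 / 2 : ENNReal) ^ n) atTop (nhds 0) :=
    ENNReal.tendsto_pow_atTop_nhds_zero_of_lt_one (by
      rw [one_div]; exact ENNReal.inv_lt_one.2 (by norm_num))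
  exact le_antisymm (ge_of_tendsto' this hle) (zero_le)

lemma proj_meas : Measurable projPi := by
  have hm : ∀ N : ℕ, Measurable (fun a : ℕ → Fin 2 =>
      ∑ n ∈ Finset.range N, ((a n : ℕ) : ℝ) * β ^ (-((n : ℤ) + 1))) := by
    intro N
    refine Finset.measurable_sum _ fun n _ => ?_
    refine Measurable.mul_const ?_ _
    exact (measurable_of_finite (fun i : Fin 2 => ((i : ℕ) : ℝ))).comp (measurable_pi_apply n)
  refine measurable_of_tendsto_metrizable hm ?_
  rw [tendsto_pi_nhds]
  intro a
  exact (summable_proj a).hasSum.tendsto_sum_nat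

lemma good_mem (a : ℕ → Fin 2) (hz : ∀ n, ∃ k, sh a n k = 0)
    (hW : ∀ n, Tendsto (fun j : ℕ => W (j ^ 2) (run (sh a n) (j ^ 2)) / (j : ℝ) ^ 4)
      atTop (nhds 0)) : projPi a ∈ freqSet (5 / 18) := by
  have hlt : ∀ n, projPi (sh a n) < β := fun n => by
    obtain ⟨k, hk⟩ := hz n
    exact proj_lt _ k hk
  refine ⟨⟨proj_nonneg a, by rw [inv_eq']; exact proj_le a⟩, ?_⟩
  change Freq (5 / 18) (projPi a)
  classical
  have hex : ∃ k, a k = 0 := hz 0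
  have h1 := one_lt
  have hT : ∀ n ≤ Nat.find hex, greedyT^[n] (projPi a) = projPi (sh a n) := by
    intro n
    induction n with
    | zero => simp [sh_zero]
    | succ n ih =>
      intro hn
      have hne : a n ≠ 0 := Nat.find_min hex (by omega)
      have h1' : a n = 1 := (fin2_cases (a n)).resolve_left hne
      have hc := proj_cons' a n
      rw [h1'] at hc
      simp at hc
      have := proj_nonneg (sh a (n + 1))
      rw [Function.iterate_succ_apply', ih (by omega), greedyT, if_neg]
      · linarith
      · rw [not_lt, div_le_iff₀ pos]; linarith
  set n0 := Nat.find hex with hn0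
  have hz0 : a n0 = 0 := Nat.find_spec hex
  rw [freq_iter _ _ n0, hT n0 le_rfl]
  apply freq_of_W
  · have hc := proj_cons' a n0
    rw [hz0] at hc
    simp at hc
    have := hlt (n0 + 1)
    nlinarith
  · intro n
    have : sh (sh a n0) n = sh a (n + n0) := by
      funext i; simp only [sh]; congr 1; omega
    rw [this]; exact hlt _
  · exact hW n0

theorem part2 (m : Measure (ℕ → Fin 2)) (hm : IsBernoulliHalf m) :
    m.map projPi (freqSet (5 / 18)) = 1 := by
  have hpm := hm.1
  have h1 : ∀ᵐ a ∂m, ∀ n, ∃ k, sh a n k = 0 := by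
    rw [ae_all_iff]
    intro n
    exact ae_of_ae_map (sh_meas n).aemeasurable (ae_zero _ (bern_sh m hm n))
  have h2 : ∀ᵐ a ∂m, ∀ n, Tendsto (fun j : ℕ => W (j ^ 2) (run (sh a n) (j ^ 2)) / (j : ℝ) ^ 4)
      atTop (nhds 0) := by
    rw [ae_all_iff]
    intro n
    exact ae_of_ae_map (sh_meas n).aemeasurable (ae_W _ (bern_sh m hm n))
  have h3 : ∀ᵐ a ∂m, a ∈ projPi ⁻¹' freqSet (5 / 18) := by
    filter_upwards [h1, h2] with a ha hb using good_mem a ha hb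
  have := Measure.isProbabilityMeasure_map (μ := m) proj_meas.aemeasurable
  refine le_antisymm prob_le_one ?_
  refine le_trans (le_of_eq ?_) (Measure.le_map_apply proj_meas.aemeasurable _)
  have h4 : (projPi ⁻¹' freqSet (5 / 18)) =ᵐ[m] Set.univ := eventuallyEq_univ.2 h3
  rw [measure_congr h4, measure_univ]

lemma five_ne : (5 / 18 : ℝ) ≠ 1 / (β ^ 2 + 1) := by
  have h := sq_eq
  have h1 := one_lt
  intro hc
  rw [eq_div_iff (by positivity), h] at hc
  have : β = 8 / 5 := by linarith
  rw [this] at h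
  norm_num at h

end GM

theorem dimH_freqSet_lt_one (m : Measure (ℕ → Fin 2)) (hm : IsBernoulliHalf m) :
    (∀ γ : ℝ, γ ≠ 1 / (goldenMean ^ 2 + 1) → dimH (freqSet γ) < 1) ∧
      m.map projPi (freqSet (5 / 18)) = 1 ∧ dimH (freqSet (5 / 18)) < 1 :=
  ⟨GM.part1, GM.part2 m hm, GM.part1 _ GM.five_ne⟩
end
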